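/- arXiv:math/0102168 — 2 statements merged into one kernel-verified Lean document; each statement's English description precedes it below -/
import Mathlib

section
/- Let l ≥ 2, n = l + 2, and let P be a Kazhdan–Lusztig family for S_n. Then P_{x_{1,l,1}, w_{1,l,1}} = 1 + q^{l−1}. -/
open scoped Classical

namespace BSW

/-- The number of inversions (the length) of a permutation of `Fin n`. -/
def invLen {n : ℕ} (w : Equiv.Perm (Fin n)) : ℕ :=
  (Finset.univ.filter (fun p : Fin n × Fin n => p.1 < p.2 ∧ w p.2 < w p.1)).card

/-- The rank function `r_w(p,q) = #{i : 1 ≤ i ≤ p and w(i) ≥ q}`, where the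
permutation of `Fin n` is regarded as a permutation of `{1,…,n}` (so position
`i : Fin n` corresponds to `i+1` and value `w i` to `(w i)+1`). -/
def rank {n : ℕ} (w : Equiv.Perm (Fin n)) (p q : ℤ) : ℕ :=
  (Finset.univ.filter (fun i : Fin n =>
    ((i : ℕ) : ℤ) + 1 ≤ p ∧ q ≤ ((w i : ℕ) : ℤ) + 1)).card

/-- The difference function `d_{x,w}(p,q) = r_w(p,q) − r_x(p,q)`. -/
def dxw {n : ℕ} (x w : Equiv.Perm (Fin n)) (p q : ℤ) : ℤ :=
  (rank w p q : ℤ) - (rank x p q : ℤ)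

/-- The Bruhat order: `x ≤ w` iff `d_{x,w}` is everywhere non-negative. -/
def bruhatLE {n : ℕ} (x w : Equiv.Perm (Fin n)) : Prop :=
  ∀ p q : ℤ, 0 ≤ dxw x w p q

/-- The set of transpositions in `S_n`. -/
def transpositions (n : ℕ) : Set (Equiv.Perm (Fin n)) :=
  {t | ∃ a b : Fin n, a ≠ b ∧ t = Equiv.swap a b}

/-- `R(x,w) = {t ∈ T : l(xt) > l(x) and xt ≤ w}`. -/
def R {n : ℕ} (x w : Equiv.Perm (Fin n)) : Set (Equiv.Perm (Fin n)) :=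
  {t | t ∈ transpositions n ∧ invLen x < invLen (x * t) ∧ bruhatLE (x * t) w}

/-- `x` is a maximal singular point (MSP) for `w`. -/
def MSP {n : ℕ} (x w : Equiv.Perm (Fin n)) : Prop :=
  bruhatLE x w ∧ ((invLen w : ℤ) - (invLen x : ℤ) < ((R x w).ncard : ℤ)) ∧
    ∀ t ∈ R x w, ((R (x * t) w).ncard : ℤ) = (invLen w : ℤ) - (invLen (x * t) : ℤ)

/-- `Δ(x,w) = {i : t_{{i,j}} ∈ R(x,w) for some j}`. -/
def Delta {n : ℕ} (x w : Equiv.Perm (Fin n)) : Set (Fin n) :=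
  {i | ∃ j : Fin n, Equiv.swap i j ∈ R x w}

/-- `Δ(x,w)` as a finset. -/
noncomputable def DeltaFinset {n : ℕ} (x w : Equiv.Perm (Fin n)) : Finset (Fin n) :=
  (Set.toFinite (Delta x w)).toFinset

/-- `σ ∈ S_k` is the flattening of `x` along the increasing enumeration `d_1 < … < d_k`
of a set `D` of positions with `#D = k`: the unique permutation of `{1,…,k}` with
`σ(a) < σ(b)` iff `x(d_a) < x(d_b)`. -/
def IsFlatteningOn {n k : ℕ} (x : Equiv.Perm (Fin n)) (D : Finset (Fin n))
    (hD : D.card = k) (σ : Equiv.Perm (Fin k)) : Prop :=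
  ∀ a b : Fin k, σ a < σ b ↔ x ((D.orderIsoOfFin hD a : Fin n)) < x ((D.orderIsoOfFin hD b : Fin n))

/-- Values (0-indexed) of the permutation `x_{k,m} = [k,…,1, k+m,…,k+1]`. -/
def xkmVal (k m i : ℕ) : ℕ :=
  if i < k then k - 1 - i else 2 * k + m - 1 - i

/-- Values (0-indexed) of the permutation `w_{k,m} = [k+m, k,…,2, k+m−1,…,k+1, 1]`. -/
def wkmVal (k m i : ℕ) : ℕ :=
  if i = 0 then k + m - 1
  else if i < k then k - i
  else if i < k + m - 1 then 2 * k + m - 2 - i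
  else 0

/-- Values (0-indexed) of the permutation `x_{k,l,m} = [k,…,1, k+l,…,k+1, k+l+m,…,k+l+1]`. -/
def xklmVal (k l m i : ℕ) : ℕ :=
  if i < k then k - 1 - i
  else if i < k + l then 2 * k + l - 1 - i
  else 2 * (k + l) + m - 1 - i

/-- Values (0-indexed) of the permutation
`w_{k,l,m} = [k+l, k,…,2, k+l+m, k+l−1,…,k+2, 1, k+l+m−1,…,k+l+1, k+1]`. -/
def wklmVal (k l m i : ℕ) : ℕ :=
  if i = 0 then k + l - 1
  else if i < k then k - i
  else if i = k then k + l + m - 1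
  else if i < k + l - 1 then 2 * k + l - 1 - i
  else if i = k + l - 1 then 0
  else if i < k + l + m - 1 then 2 * (k + l) + m - 2 - i
  else k


/-- `μ(z,w)`: the coefficient of `q^{(l(w)−l(z)−1)/2}` in `P z w`, interpreted as `0`
when `l(w) − l(z)` is even. -/
noncomputable def klmu {n : ℕ}
    (P : Equiv.Perm (Fin n) → Equiv.Perm (Fin n) → Polynomial ℤ)
    (z w : Equiv.Perm (Fin n)) : ℤ :=
  if (invLen w - invLen z) % 2 = 1 then
    (P z w).coeff ((invLen w - invLen z - 1) / 2)
  else 0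

/-- A Kazhdan–Lusztig family for `S_n`: a family of polynomials `P x w ∈ ℤ[q]`
(`q = Polynomial.X`) satisfying the defining properties of the Kazhdan–Lusztig
polynomials: (1) `P x w = 0` unless `x ≤ w`; (2) `P x w = 1` if `x ≤ w` and
`l(w) − l(x) ≤ 2`; (3) `deg (P x w) ≤ (l(w) − l(x) − 1)/2` whenever `x ≤ w`; and
(4) the Kazhdan–Lusztig recurrence with respect to any simple transposition
`s = t_{a,a+1}` with `l(ws) < l(w)`. -/
structure KLFamily (n : ℕ) where
  P : Equiv.Perm (Fin n) → Equiv.Perm (Fin n) → Polynomial ℤ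
  eq_zero : ∀ x w, ¬ bruhatLE x w → P x w = 0
  eq_one : ∀ x w, bruhatLE x w → invLen w ≤ invLen x + 2 → P x w = 1
  deg_le : ∀ x w, bruhatLE x w → 2 * (P x w).natDegree ≤ invLen w - invLen x - 1
  recurrence : ∀ (x w : Equiv.Perm (Fin n)) (a b : Fin n), (b : ℕ) = (a : ℕ) + 1 →
    invLen (w * Equiv.swap a b) < invLen w →
    P x w =
      (if invLen (x * Equiv.swap a b) < invLen x then Polynomial.X else 1) *
          P x (w * Equiv.swap a b)
        + (if invLen (x * Equiv.swap a b) < invLen x then 1 else Polynomial.X) *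
          P (x * Equiv.swap a b) (w * Equiv.swap a b)
        - ∑ z : Equiv.Perm (Fin n),
            if bruhatLE x z ∧ bruhatLE z (w * Equiv.swap a b) ∧ z ≠ w * Equiv.swap a b ∧
                invLen (z * Equiv.swap a b) < invLen z then
              Polynomial.C (klmu P z (w * Equiv.swap a b)) *
                Polynomial.X ^ ((invLen w - invLen z) / 2) * P x z
            else 0

/-! ### Lengths and adjacent transpositions -/

/-- The adjacent transposition exchanging the positions `i` and `i + 1`. -/
def adj {n : ℕ} (i : ℕ) (hi : i + 1 < n) : Equiv.Perm (Fin n) :=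
  Equiv.swap ⟨i, Nat.lt_of_succ_lt hi⟩ ⟨i + 1, hi⟩

/-- The action of an adjacent transposition on natural numbers. -/
def adjNat (i k : ℕ) : ℕ := if k = i then i + 1 else if k = i + 1 then i else k

lemma adj_val {n : ℕ} (i : ℕ) (hi : i + 1 < n) (p : Fin n) :
    (adj i hi p : ℕ) = adjNat i p := by
  unfold adj adjNat
  rw [Equiv.swap_apply_def]
  simp only [Fin.ext_iff]
  split_ifs <;> rfl

lemma adj_mul_adj {n : ℕ} (i : ℕ) (hi : i + 1 < n) (x : Equiv.Perm (Fin n)) :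
    x * adj i hi * adj i hi = x := by
  simp [adj, mul_assoc]

lemma adj_adj {n : ℕ} (i : ℕ) (hi : i + 1 < n) (p : Fin n) : adj i hi (adj i hi p) = p := by
  simp [adj]

lemma adj_lt_adj {n : ℕ} (i : ℕ) (hi : i + 1 < n) {p q : Fin n} (hpq : p < q)
    (h : ¬ ((p : ℕ) = i ∧ (q : ℕ) = i + 1)) : adj i hi p < adj i hi q := by
  rw [Fin.lt_def, adj_val, adj_val]
  rw [Fin.lt_def] at hpq
  unfold adjNat
  split_ifs <;> omega

lemma invLen_lt_of_lt {n : ℕ} (x : Equiv.Perm (Fin n)) (i : ℕ) (hi : i + 1 < n)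
    (h : x ⟨i, Nat.lt_of_succ_lt hi⟩ < x ⟨i + 1, hi⟩) : invLen x < invLen (x * adj i hi) := by
  unfold invLen
  rw [← Finset.card_map ((adj i hi).prodCongr (adj i hi)).toEmbedding]
  apply Finset.card_lt_card
  rw [Finset.ssubset_iff_of_subset]
  · refine ⟨(⟨i, Nat.lt_of_succ_lt hi⟩, ⟨i + 1, hi⟩), ?_, ?_⟩
    · refine Finset.mem_filter.2 ⟨Finset.mem_univ _, by simp [Fin.lt_def], ?_⟩
      simpa [adj] using h
    · simp only [Finset.mem_map, Finset.mem_filter, Finset.mem_univ, true_and, not_exists,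
        Equiv.coe_toEmbedding, Prod.forall, Equiv.prodCongr_apply, Prod.map_apply, Prod.mk.injEq]
      rintro p q ⟨⟨hpq, _⟩, hp, hq⟩
      have h1 := congrArg (adj i hi) hp
      have h2 := congrArg (adj i hi) hq
      rw [adj_adj] at h1 h2
      rw [h1, h2, Fin.lt_def, adj_val, adj_val] at hpq
      simp [adjNat] at hpq
  · intro r
    simp only [Finset.mem_map, Finset.mem_filter, Finset.mem_univ, true_and,
      Equiv.coe_toEmbedding, Prod.exists, Equiv.prodCongr_apply]
    rintro ⟨p, q, ⟨hpq, hx⟩, rfl⟩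
    simp only [Prod.map_apply, Equiv.Perm.mul_apply, adj_adj]
    refine ⟨adj_lt_adj i hi hpq ?_, hx⟩
    rintro ⟨h1, h2⟩
    have e1 : p = ⟨i, Nat.lt_of_succ_lt hi⟩ := Fin.ext h1
    have e2 : q = ⟨i + 1, hi⟩ := Fin.ext h2
    subst e1 e2
    exact absurd hx (not_lt.2 h.le)

lemma invLen_mul_adj_lt_iff {n : ℕ} (x : Equiv.Perm (Fin n)) (i : ℕ) (hi : i + 1 < n) :
    invLen (x * adj i hi) < invLen x ↔ x ⟨i + 1, hi⟩ < x ⟨i, Nat.lt_of_succ_lt hi⟩ := by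
  constructor
  · intro h
    by_contra hc
    rcases (not_lt.1 hc).lt_or_eq with h1 | h1
    · exact absurd (invLen_lt_of_lt x i hi h1) (not_lt.2 h.le)
    · simpa [Fin.ext_iff] using x.injective h1
  · intro h
    have := invLen_lt_of_lt (x * adj i hi) i hi (by simpa [adj] using h)
    rwa [adj_mul_adj] at this

lemma invLen_mul_adj_lt_iff_not {n : ℕ} (x : Equiv.Perm (Fin n)) (i : ℕ) (hi : i + 1 < n) :
    invLen (x * adj i hi * adj i hi) < invLen (x * adj i hi) ↔
      ¬ invLen (x * adj i hi) < invLen x := by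
  rw [invLen_mul_adj_lt_iff, invLen_mul_adj_lt_iff]
  have : x ⟨i, Nat.lt_of_succ_lt hi⟩ ≠ x ⟨i + 1, hi⟩ := by simp [Fin.ext_iff]
  simp only [Equiv.Perm.mul_apply, adj, Equiv.swap_apply_left, Equiv.swap_apply_right]
  rw [not_lt]
  exact ⟨le_of_lt, fun h => lt_of_le_of_ne h this⟩

/-- The number of non-inversions of a permutation. -/
def coInvLen {n : ℕ} (w : Equiv.Perm (Fin n)) : ℕ :=
  (Finset.univ.filter (fun p : Fin n × Fin n => p.1 < p.2 ∧ w p.1 < w p.2)).card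

lemma invLen_add_coInvLen {n : ℕ} (w : Equiv.Perm (Fin n)) :
    invLen w + coInvLen w =
      (Finset.univ.filter (fun p : Fin n × Fin n => p.1 < p.2)).card := by
  unfold invLen coInvLen
  rw [← Finset.card_filter_add_card_filter_not (s := Finset.univ.filter
    (fun p : Fin n × Fin n => p.1 < p.2)) (fun p => w p.2 < w p.1),
    Finset.filter_filter, Finset.filter_filter]
  congr 2
  apply Finset.filter_congr
  rintro ⟨p, q⟩ -
  simp only [not_lt, and_congr_right_iff]
  intro h
  have : w p ≠ w q := fun e => h.ne (w.injective e)
  exact ⟨le_of_lt, fun h => lt_of_le_of_ne h this⟩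

/-! ### Permutations which are decreasing away from their minimum and maximum -/

/-- The pairs of positions `p < q` with `p = a` or `q = b`. -/
def hook (n a b : ℕ) : Finset (Fin n × Fin n) :=
  Finset.univ.filter (fun p => p.1 < p.2 ∧ ((p.1 : ℕ) = a ∨ (p.2 : ℕ) = b))

lemma card_hook {n a b : ℕ} (ha : a < n) (hb : b < n) :
    (hook n a b).card + (if a < b then 1 else 0) = n - 1 - a + b := by
  have hA : (Finset.univ.filter (fun p : Fin n × Fin n => p.1 < p.2 ∧ (p.1 : ℕ) = a)).card
      = n - 1 - a := by
    have : Finset.univ.filter (fun p : Fin n × Fin n => p.1 < p.2 ∧ (p.1 : ℕ) = a)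
        = (Finset.Ioi (⟨a, ha⟩ : Fin n)).map
          ⟨fun q => ((⟨a, ha⟩ : Fin n), q), fun _ _ h => (Prod.mk.inj h).2⟩ := by
      ext ⟨p, q⟩
      simp only [Finset.mem_filter, Finset.mem_univ, true_and, Finset.mem_map, Finset.mem_Ioi]
      constructor
      · rintro ⟨h, rfl⟩
        exact ⟨q, h, rfl⟩
      · rintro ⟨r, h, h1⟩
        obtain ⟨rfl, rfl⟩ := Prod.mk.inj h1
        exact ⟨h, rfl⟩
    rw [this, Finset.card_map, Fin.card_Ioi]
  have hB : (Finset.univ.filter (fun p : Fin n × Fin n => p.1 < p.2 ∧ (p.2 : ℕ) = b)).card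
      = b := by
    have : Finset.univ.filter (fun p : Fin n × Fin n => p.1 < p.2 ∧ (p.2 : ℕ) = b)
        = (Finset.Iio (⟨b, hb⟩ : Fin n)).map
          ⟨fun q => (q, (⟨b, hb⟩ : Fin n)), fun _ _ h => (Prod.mk.inj h).1⟩ := by
      ext ⟨p, q⟩
      simp only [Finset.mem_filter, Finset.mem_univ, true_and, Finset.mem_map, Finset.mem_Iio]
      constructor
      · rintro ⟨h, rfl⟩
        exact ⟨p, h, rfl⟩
      · rintro ⟨r, h, h1⟩
        obtain ⟨rfl, rfl⟩ := Prod.mk.inj h1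
        exact ⟨h, rfl⟩
    rw [this, Finset.card_map, Fin.card_Iio]
  have hU : hook n a b = Finset.univ.filter (fun p : Fin n × Fin n => p.1 < p.2 ∧ (p.1 : ℕ) = a)
      ∪ Finset.univ.filter (fun p : Fin n × Fin n => p.1 < p.2 ∧ (p.2 : ℕ) = b) := by
    ext p
    simp only [hook, Finset.mem_filter, Finset.mem_univ, true_and, Finset.mem_union]
    tauto
  have hI : (Finset.univ.filter (fun p : Fin n × Fin n => p.1 < p.2 ∧ (p.1 : ℕ) = a)
      ∩ Finset.univ.filter (fun p : Fin n × Fin n => p.1 < p.2 ∧ (p.2 : ℕ) = b)).card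
      = if a < b then 1 else 0 := by
    split_ifs with h
    · rw [Finset.card_eq_one]
      refine ⟨(⟨a, ha⟩, ⟨b, hb⟩), ?_⟩
      ext ⟨p, q⟩
      simp only [Finset.mem_inter, Finset.mem_filter, Finset.mem_univ, true_and,
        Finset.mem_singleton, Prod.mk.injEq, Fin.ext_iff, Fin.lt_def]
      omega
    · rw [Finset.card_eq_zero, Finset.eq_empty_iff_forall_notMem]
      rintro ⟨p, q⟩
      simp only [Finset.mem_inter, Finset.mem_filter, Finset.mem_univ, true_and, Fin.lt_def]
      omega
  rw [hU, ← hI, Finset.card_union_add_card_inter, hA, hB]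

/-- `z` takes its minimal value at position `a`, its maximal value at position `b`, and is
decreasing on the other positions. -/
def DecreasingOff {n : ℕ} (z : Equiv.Perm (Fin n)) (a b : ℕ) : Prop :=
  ∀ p q : Fin n, p < q → (z p < z q ↔ (p : ℕ) = a ∨ (q : ℕ) = b)

lemma DecreasingOff.coInvLen_eq {n a b : ℕ} {z : Equiv.Perm (Fin n)} (h : DecreasingOff z a b) :
    coInvLen z = (hook n a b).card := by
  unfold coInvLen hook
  congr 1
  apply Finset.filter_congr
  rintro ⟨p, q⟩ -
  simp only [and_congr_right_iff]
  exact h p q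

lemma DecreasingOff.unique {n a b : ℕ} {z z' : Equiv.Perm (Fin n)} (h : DecreasingOff z a b)
    (h' : DecreasingOff z' a b) : z = z' := by
  have key : ∀ p q : Fin n, z p < z q → z' p < z' q := by
    intro p q hpq
    rcases lt_trichotomy p q with hlt | rfl | hlt
    · exact (h' p q hlt).2 ((h p q hlt).1 hpq)
    · exact absurd hpq (lt_irrefl _)
    · by_contra hc
      have h1 : z' q < z' p := lt_of_le_of_ne (not_lt.1 hc) (by simpa using hlt.ne)
      exact absurd ((h q p hlt).2 ((h' q p hlt).1 h1)) (not_lt.2 hpq.le)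
  have hm : StrictMono (z.symm.trans z') := by
    intro u v huv
    simpa using key (z.symm u) (z.symm v) (by simpa using huv)
  have : (⇑(z.symm.trans z') : Fin n → Fin n) = id := by
    have := hm.range_inj (strictMono_id (α := Fin n))
    exact this.1 (by simp)
  ext p
  have := congrFun this (z p)
  simp at this
  rw [this]

lemma DecreasingOff.mul_adj {n a b : ℕ} {z : Equiv.Perm (Fin n)} (h : DecreasingOff z a b)
    (hab : a ≠ b) (i : ℕ) (hi : i + 1 < n) (hm : a = i ∨ a = i + 1 ∨ b = i ∨ b = i + 1) :
    DecreasingOff (z * adj i hi) (adjNat i a) (adjNat i b) := by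
  intro p q hpq
  by_cases hc : (p : ℕ) = i ∧ (q : ℕ) = i + 1
  · have e1 : p = ⟨i, Nat.lt_of_succ_lt hi⟩ := Fin.ext hc.1
    have e2 : q = ⟨i + 1, hi⟩ := Fin.ext hc.2
    have hz : z p ≠ z q := by simpa using hpq.ne
    have := h p q hpq
    have h2 : (z * adj i hi) p < (z * adj i hi) q ↔ ¬ z p < z q := by
      subst e1 e2
      simp only [Equiv.Perm.mul_apply, adj, Equiv.swap_apply_left, Equiv.swap_apply_right, not_lt]
      exact ⟨le_of_lt, fun h => lt_of_le_of_ne h hz.symm⟩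
    rw [h2, this, hc.1, hc.2]
    unfold adjNat
    split_ifs <;> omega
  · have := h _ _ (adj_lt_adj i hi hpq hc)
    rw [Equiv.Perm.mul_apply, Equiv.Perm.mul_apply, this, adj_val, adj_val]
    unfold adjNat
    split_ifs <;> omega

/-! ### Positions of the extreme values -/

/-- The position of the minimal value. -/
def posMin {l : ℕ} (x : Equiv.Perm (Fin (l + 2))) : ℕ := (x.symm 0 : ℕ)

/-- The position of the maximal value. -/
def posMax {l : ℕ} (x : Equiv.Perm (Fin (l + 2))) : ℕ := (x.symm (Fin.last (l + 1)) : ℕ)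

lemma posMin_lt {l : ℕ} (x : Equiv.Perm (Fin (l + 2))) : posMin x < l + 2 := (x.symm 0).2

lemma posMax_lt {l : ℕ} (x : Equiv.Perm (Fin (l + 2))) : posMax x < l + 2 :=
  (x.symm (Fin.last (l + 1))).2

lemma posMin_ne_posMax {l : ℕ} (x : Equiv.Perm (Fin (l + 2))) : posMin x ≠ posMax x := by
  intro h
  have := x.symm.injective (Fin.ext h)
  simp [Fin.ext_iff] at this

lemma posMin_eq_iff {l : ℕ} (x : Equiv.Perm (Fin (l + 2))) (p : Fin (l + 2)) :
    (p : ℕ) = posMin x ↔ x p = 0 := by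
  rw [posMin, ← Fin.ext_iff, Equiv.eq_symm_apply]

lemma posMax_eq_iff {l : ℕ} (x : Equiv.Perm (Fin (l + 2))) (p : Fin (l + 2)) :
    (p : ℕ) = posMax x ↔ x p = Fin.last (l + 1) := by
  rw [posMax, ← Fin.ext_iff, Equiv.eq_symm_apply]

lemma posMin_mul_adj {l : ℕ} (x : Equiv.Perm (Fin (l + 2))) (i : ℕ) (hi : i + 1 < l + 2) :
    posMin (x * adj i hi) = adjNat i (posMin x) := by
  have h : (adj i hi (x.symm 0) : ℕ) = posMin (x * adj i hi) := by
    rw [posMin_eq_iff, Equiv.Perm.mul_apply, adj_adj, Equiv.apply_symm_apply]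
  rw [← h, adj_val, posMin]

lemma posMax_mul_adj {l : ℕ} (x : Equiv.Perm (Fin (l + 2))) (i : ℕ) (hi : i + 1 < l + 2) :
    posMax (x * adj i hi) = adjNat i (posMax x) := by
  have h : (adj i hi (x.symm (Fin.last _)) : ℕ) = posMax (x * adj i hi) := by
    rw [posMax_eq_iff, Equiv.Perm.mul_apply, adj_adj, Equiv.apply_symm_apply]
  rw [← h, adj_val, posMax]

/-- A descent at `i` excludes the minimum at `i` and the maximum at `i + 1`. -/
lemma pos_of_descent {l : ℕ} {x : Equiv.Perm (Fin (l + 2))} {i : ℕ} {hi : i + 1 < l + 2}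
    (h : invLen (x * adj i hi) < invLen x) : posMin x ≠ i ∧ posMax x ≠ i + 1 := by
  rw [invLen_mul_adj_lt_iff] at h
  constructor
  · intro h1
    rw [(posMin_eq_iff x ⟨i, Nat.lt_of_succ_lt hi⟩).1 h1.symm] at h
    exact absurd h (Fin.not_lt_zero _)
  · intro h1
    rw [(posMax_eq_iff x ⟨i + 1, hi⟩).1 h1.symm] at h
    exact absurd h (not_lt.2 (Fin.le_last _))

/-- An ascent at `i` excludes the minimum at `i + 1` and the maximum at `i`. -/
lemma pos_of_not_descent {l : ℕ} {x : Equiv.Perm (Fin (l + 2))} {i : ℕ} {hi : i + 1 < l + 2}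
    (h : ¬ invLen (x * adj i hi) < invLen x) : posMin x ≠ i + 1 ∧ posMax x ≠ i := by
  have := pos_of_descent ((invLen_mul_adj_lt_iff_not x i hi).2 h)
  rw [posMin_mul_adj, posMax_mul_adj] at this
  unfold adjNat at this
  constructor
  · intro h1
    simp [h1] at this
  · intro h1
    simp [h1] at this

lemma hook_subset {l : ℕ} (z : Equiv.Perm (Fin (l + 2))) :
    hook (l + 2) (posMin z) (posMax z) ⊆ Finset.univ.filter
      (fun p : Fin (l + 2) × Fin (l + 2) => p.1 < p.2 ∧ z p.1 < z p.2) := by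
  rintro ⟨p, q⟩
  simp only [hook, Finset.mem_filter, Finset.mem_univ, true_and]
  rintro ⟨hpq, h⟩
  refine ⟨hpq, ?_⟩
  have hz : z p ≠ z q := by simpa using hpq.ne
  rcases h with h | h
  · rw [posMin_eq_iff] at h
    rw [h] at hz ⊢
    exact Fin.pos_of_ne_zero hz.symm
  · rw [posMax_eq_iff] at h
    rw [h] at hz ⊢
    exact Fin.lt_last_iff_ne_last.2 hz

lemma card_hook_le_coInvLen {l : ℕ} (z : Equiv.Perm (Fin (l + 2))) :
    (hook (l + 2) (posMin z) (posMax z)).card ≤ coInvLen z :=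
  Finset.card_le_card (hook_subset z)

lemma decreasingOff_of_coInvLen_le {l : ℕ} {z : Equiv.Perm (Fin (l + 2))}
    (h : coInvLen z ≤ (hook (l + 2) (posMin z) (posMax z)).card) :
    DecreasingOff z (posMin z) (posMax z) := by
  have := Finset.eq_of_subset_of_card_le (hook_subset z) h
  intro p q hpq
  have := Finset.ext_iff.1 this (p, q)
  simp only [hook, Finset.mem_filter, Finset.mem_univ, true_and, hpq] at this
  exact this.symm

lemma DecreasingOff.posMin_eq {l a b : ℕ} {z : Equiv.Perm (Fin (l + 2))}
    (h : DecreasingOff z a b) (hab : a ≠ b) (ha : a < l + 2) : posMin z = a := by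
  by_contra hne
  have hz : z (z.symm 0) = 0 := z.apply_symm_apply 0
  have hpos : (0 : Fin (l + 2)) < z ⟨a, ha⟩ := by
    apply Fin.pos_of_ne_zero
    intro h0
    exact hne ((posMin_eq_iff z ⟨a, ha⟩).2 h0).symm
  rcases lt_trichotomy (z.symm 0) ⟨a, ha⟩ with hlt | heq | hlt
  · have := (h _ _ hlt).1 (by rw [hz]; exact hpos)
    exact this.elim hne hab
  · exact hne (congrArg Fin.val heq)
  · have := (h _ _ hlt).2 (Or.inl rfl)
    rw [hz] at this
    exact absurd this (Fin.not_lt_zero _)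

lemma DecreasingOff.posMax_eq {l a b : ℕ} {z : Equiv.Perm (Fin (l + 2))}
    (h : DecreasingOff z a b) (hab : a ≠ b) (hb : b < l + 2) : posMax z = b := by
  by_contra hne
  have hz : z (z.symm (Fin.last _)) = Fin.last _ := z.apply_symm_apply _
  have hpos : z ⟨b, hb⟩ < Fin.last (l + 1) := by
    apply Fin.lt_last_iff_ne_last.2
    intro h0
    exact hne ((posMax_eq_iff z ⟨b, hb⟩).2 h0).symm
  rcases lt_trichotomy ⟨b, hb⟩ (z.symm (Fin.last _)) with hlt | heq | hlt
  · have := (h _ _ hlt).1 (by rw [hz]; exact hpos)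
    exact this.elim (fun e => hab e.symm) hne
  · exact hne (congrArg Fin.val heq).symm
  · have := (h _ _ hlt).2 (Or.inr rfl)
    rw [hz] at this
    exact absurd this (not_lt.2 (Fin.le_last _))

lemma DecreasingOff.descent_iff {n a b : ℕ} {z : Equiv.Perm (Fin n)} (h : DecreasingOff z a b)
    (i : ℕ) (hi : i + 1 < n) : invLen (z * adj i hi) < invLen z ↔ ¬ (i = a ∨ i + 1 = b) := by
  rw [invLen_mul_adj_lt_iff]
  have := h ⟨i, Nat.lt_of_succ_lt hi⟩ ⟨i + 1, hi⟩ (by simp [Fin.lt_def])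
  have hz : z ⟨i, Nat.lt_of_succ_lt hi⟩ ≠ z ⟨i + 1, hi⟩ := by simp [Fin.ext_iff]
  rw [← this, not_lt]
  exact ⟨le_of_lt, fun h => lt_of_le_of_ne h hz.symm⟩

/-! ### The Bruhat order and Kazhdan–Lusztig families -/

lemma bruhatLE_refl {n : ℕ} (x : Equiv.Perm (Fin n)) : bruhatLE x x := by
  intro p q
  simp [dxw]

lemma bruhatLE.exists_le {n : ℕ} {x v : Equiv.Perm (Fin n)} (h : bruhatLE x v) (i : Fin n) :
    ∃ j, j ≤ i ∧ x i ≤ v j := by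
  have h1 := h ((i : ℕ) + 1) ((x i : ℕ) + 1)
  have h2 : 0 < rank x ((i : ℕ) + 1) ((x i : ℕ) + 1) := by
    apply Finset.card_pos.2
    exact ⟨i, Finset.mem_filter.2 ⟨Finset.mem_univ _, le_refl _, le_refl _⟩⟩
  have h3 : 0 < rank v ((i : ℕ) + 1) ((x i : ℕ) + 1) := by
    unfold dxw at h1
    omega
  obtain ⟨j, hj⟩ := Finset.card_pos.1 h3
  obtain ⟨-, h4, h5⟩ := Finset.mem_filter.1 hj
  refine ⟨j, ?_, ?_⟩
  · rw [Fin.le_def]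
    omega
  · rw [Fin.le_def]
    omega

namespace KLFamily

lemma P_self {n : ℕ} (F : KLFamily n) (x : Equiv.Perm (Fin n)) : F.P x x = 1 :=
  F.eq_one x x (bruhatLE_refl x) (by omega)

lemma klmu_self {n : ℕ} (F : KLFamily n) (x : Equiv.Perm (Fin n)) : klmu F.P x x = 0 := by
  simp [klmu]

/-- The recurrence, without the conditions in the sum that hold automatically for all
nonzero terms. -/
lemma recurrence_adj {n : ℕ} (F : KLFamily n) (x w : Equiv.Perm (Fin n)) (i : ℕ)
    (hi : i + 1 < n) (hw : invLen (w * adj i hi) < invLen w) :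
    F.P x w =
      (if invLen (x * adj i hi) < invLen x then Polynomial.X else 1) * F.P x (w * adj i hi)
        + (if invLen (x * adj i hi) < invLen x then 1 else Polynomial.X) *
          F.P (x * adj i hi) (w * adj i hi)
        - ∑ z : Equiv.Perm (Fin n),
            if invLen (z * adj i hi) < invLen z then
              Polynomial.C (klmu F.P z (w * adj i hi)) *
                Polynomial.X ^ ((invLen w - invLen z) / 2) * F.P x z
            else 0 := by
  refine (F.recurrence x w ⟨i, Nat.lt_of_succ_lt hi⟩ ⟨i + 1, hi⟩ rfl hw).trans ?_
  congr 1
  apply Finset.sum_congr rfl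
  intro z _
  change (if bruhatLE x z ∧ bruhatLE z (w * adj i hi) ∧ z ≠ w * adj i hi ∧
    invLen (z * adj i hi) < invLen z then _ else _) = _
  by_cases h : bruhatLE x z ∧ bruhatLE z (w * adj i hi) ∧ z ≠ w * adj i hi
  · simp only [h, true_and, not_false_eq_true, ne_eq]
    rfl
  · rw [if_neg (fun h' => h ⟨h'.1, h'.2.1, h'.2.2.1⟩)]
    split_ifs
    · symm
      by_cases h1 : bruhatLE x z
      · by_cases h2 : z = w * adj i hi
        · rw [h2, klmu_self]
          simp
        · have h3 : ¬ bruhatLE z (w * adj i hi) := fun h3 => h ⟨h1, h3, h2⟩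
          simp [klmu, F.eq_zero _ _ h3]
      · simp [F.eq_zero _ _ h1]
    · rfl

/-- The polynomials `P x w` are constant on the cosets of a right descent of `w`. -/
lemma P_mul_adj_left {n : ℕ} (F : KLFamily n) (x w : Equiv.Perm (Fin n)) (i : ℕ)
    (hi : i + 1 < n) (hw : invLen (w * adj i hi) < invLen w) :
    F.P (x * adj i hi) w = F.P x w := by
  induction hm : invLen w using Nat.strong_induction_on generalizing w with
  | _ m ih =>
    rw [F.recurrence_adj x w i hi hw, F.recurrence_adj (x * adj i hi) w i hi hw, adj_mul_adj]
    congr 1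
    · have := invLen_mul_adj_lt_iff_not x i hi
      rw [adj_mul_adj] at this
      simp only [this]
      split_ifs <;> ring
    · apply Finset.sum_congr rfl
      intro z _
      split_ifs with hz
      · by_cases hk : klmu F.P z (w * adj i hi) = 0
        · simp [hk]
        · have : (invLen (w * adj i hi) - invLen z) % 2 = 1 := by
            by_contra hc
            exact hk (if_neg hc)
          rw [ih (invLen z) (by omega) z hz rfl]
      · rfl

/-- The recurrence when the correction terms come from elements one shorter than `v`. -/
lemma P_mul_adj {n : ℕ} (F : KLFamily n) (v : Equiv.Perm (Fin n)) (i : ℕ) (hi : i + 1 < n)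
    (hv : invLen v < invLen (v * adj i hi)) (Z : Finset (Equiv.Perm (Fin n)))
    (hZ : ∀ z, invLen (z * adj i hi) < invLen z → klmu F.P z v ≠ 0 → z ∈ Z)
    (hZ' : ∀ z ∈ Z, invLen (z * adj i hi) < invLen z ∧ klmu F.P z v = 1 ∧
      invLen (v * adj i hi) = invLen z + 2)
    (x : Equiv.Perm (Fin n)) :
    F.P x (v * adj i hi) =
      (if invLen (x * adj i hi) < invLen x then Polynomial.X else 1) * F.P x v
        + (if invLen (x * adj i hi) < invLen x then 1 else Polynomial.X) *
          F.P (x * adj i hi) v - ∑ z ∈ Z, Polynomial.X * F.P x z := by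
  have := F.recurrence_adj x (v * adj i hi) i hi (by rwa [adj_mul_adj])
  rw [adj_mul_adj] at this
  rw [this]
  congr 1
  rw [← Finset.sum_subset (Finset.subset_univ Z)]
  · apply Finset.sum_congr rfl
    intro z hz
    obtain ⟨h1, h2, h3⟩ := hZ' z hz
    rw [if_pos h1, h2, h3, Nat.add_sub_cancel_left]
    simp
  · intro z _ hz
    split_ifs with h
    · have : klmu F.P z v = 0 := by
        by_contra hc
        exact hz (hZ z h hc)
      simp [this]
    · rfl

lemma klmu_of_eq_one {n : ℕ} (F : KLFamily n) {z v : Equiv.Perm (Fin n)} (h : F.P z v = 1) :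
    klmu F.P z v = if invLen v = invLen z + 1 then 1 else 0 := by
  unfold klmu
  rw [h, Polynomial.coeff_one]
  split_ifs <;> first | rfl | omega

lemma klmu_of_eq_zero {n : ℕ} (F : KLFamily n) {z v : Equiv.Perm (Fin n)} (h : F.P z v = 0) :
    klmu F.P z v = 0 := by
  simp [klmu, h]

end KLFamily

/-! ### Comparison of lengths -/

lemma invLen_add_le {l a b : ℕ} {v : Equiv.Perm (Fin (l + 2))} (hv : DecreasingOff v a b)
    (ha : a < l + 2) (hb : b < l + 2) (z : Equiv.Perm (Fin (l + 2))) :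
    invLen z + (l + 1 - posMin z + posMax z) + (if a < b then 1 else 0) ≤
      invLen v + (l + 1 - a + b) + (if posMin z < posMax z then 1 else 0) := by
  have h1 := invLen_add_coInvLen z
  have h2 := invLen_add_coInvLen v
  have h3 := hv.coInvLen_eq
  have h4 := card_hook_le_coInvLen z
  have h5 := card_hook (posMin_lt z) (posMax_lt z)
  have h6 := card_hook ha hb
  omega

lemma decreasingOff_of_le_invLen_add {l a b : ℕ} {v : Equiv.Perm (Fin (l + 2))}
    (hv : DecreasingOff v a b) (ha : a < l + 2) (hb : b < l + 2) {z : Equiv.Perm (Fin (l + 2))}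
    (h : invLen v + (l + 1 - a + b) + (if posMin z < posMax z then 1 else 0) ≤
      invLen z + (l + 1 - posMin z + posMax z) + (if a < b then 1 else 0)) :
    DecreasingOff z (posMin z) (posMax z) := by
  have h1 := invLen_add_coInvLen z
  have h2 := invLen_add_coInvLen v
  have h3 := hv.coInvLen_eq
  have h5 := card_hook (posMin_lt z) (posMax_lt z)
  have h6 := card_hook ha hb
  exact decreasingOff_of_coInvLen_le (by omega)

lemma DecreasingOff.invLen_eq {l a b a' b' : ℕ} {v v' : Equiv.Perm (Fin (l + 2))}
    (hv : DecreasingOff v a b) (hv' : DecreasingOff v' a' b') (ha : a < l + 2) (hb : b < l + 2)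
    (ha' : a' < l + 2) (hb' : b' < l + 2) :
    invLen v' + (l + 1 - a' + b') + (if a < b then 1 else 0) =
      invLen v + (l + 1 - a + b) + (if a' < b' then 1 else 0) := by
  have h1 := invLen_add_coInvLen v
  have h2 := invLen_add_coInvLen v'
  have h3 := hv.coInvLen_eq
  have h4 := hv'.coInvLen_eq
  have h5 := card_hook ha hb
  have h6 := card_hook ha' hb'
  omega

/-! ### The minimum in first position -/

lemma decreasingOff_of_descents {l : ℕ} {x : Equiv.Perm (Fin (l + 2))} (h0 : posMin x = 0)
    (h1 : posMax x = l + 1)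
    (h : ∀ i (hi : i + 1 < l + 2), 1 ≤ i → i + 1 ≤ l → invLen (x * adj i hi) < invLen x) :
    DecreasingOff x 0 (l + 1) := by
  have key : ∀ d i (hi : i + d + 1 < l + 2), 1 ≤ i → i + d + 1 ≤ l →
      x ⟨i + d + 1, hi⟩ < x ⟨i, by omega⟩ := by
    intro d
    induction d with
    | zero =>
      intro i hi h2 h3
      exact (invLen_mul_adj_lt_iff x i hi).1 (h i hi h2 h3)
    | succ d ih =>
      intro i hi h2 h3
      exact ((invLen_mul_adj_lt_iff x (i + d + 1) hi).1
        (h (i + d + 1) hi (by omega) (by omega))).trans (ih i (by omega) h2 (by omega))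
  intro p q hpq
  have hsub : (p : ℕ) = 0 ∨ (q : ℕ) = l + 1 → x p < x q := by
    intro hc
    have hm : (p, q) ∈ hook (l + 2) (posMin x) (posMax x) :=
      Finset.mem_filter.2 ⟨Finset.mem_univ _, hpq, by rwa [h0, h1]⟩
    exact (Finset.mem_filter.1 (hook_subset x hm)).2.2
  refine ⟨fun hx => ?_, hsub⟩
  by_contra hc
  rw [Fin.lt_def] at hpq
  have hq := q.2
  obtain ⟨d, hd⟩ : ∃ d, (q : ℕ) = p + d + 1 := ⟨q - p - 1, by omega⟩
  have := key d p (by omega) (by omega) (by omega)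
  have e : (⟨(p : ℕ) + d + 1, by omega⟩ : Fin (l + 2)) = q := Fin.ext hd.symm
  rw [e] at this
  exact absurd hx (not_lt.2 this.le)

namespace KLFamily

variable {l : ℕ} (F : KLFamily (l + 2))

/-- The polynomials below the longest element of `S_1 × S_l × S_1`. -/
lemma P_zero_last {v : Equiv.Perm (Fin (l + 2))} (hv : DecreasingOff v 0 (l + 1))
    (x : Equiv.Perm (Fin (l + 2))) :
    F.P x v = if posMin x = 0 ∧ l + 1 ≤ posMax x then 1 else 0 := by
  have hv0 : posMin v = 0 := hv.posMin_eq (by omega) (by omega)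
  have hv1 : posMax v = l + 1 := hv.posMax_eq (by omega) (by omega)
  split_ifs with h
  · obtain ⟨h0, h1⟩ := h
    induction hm : coInvLen x using Nat.strong_induction_on generalizing x with
    | _ m ih =>
      by_cases hd : ∀ i (hi : i + 1 < l + 2), 1 ≤ i → i + 1 ≤ l →
          invLen (x * adj i hi) < invLen x
      · have h2 := posMax_lt x
        rw [(decreasingOff_of_descents h0 (by omega) hd).unique hv, F.P_self]
      · push Not at hd
        obtain ⟨i, hi, h2, h3, h4⟩ := hd
        rw [← F.P_mul_adj_left x v i hi ((hv.descent_iff i hi).2 (by omega))]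
        refine ih _ ?_ _ ?_ ?_ rfl
        · have h5 := (invLen_mul_adj_lt_iff_not x i hi).2 (not_lt.2 h4)
          rw [adj_mul_adj] at h5
          have h6 := invLen_add_coInvLen x
          have h7 := invLen_add_coInvLen (x * adj i hi)
          omega
        · rw [posMin_mul_adj, h0]
          unfold adjNat
          rw [if_neg (by omega), if_neg (by omega)]
        · rw [posMax_mul_adj]
          unfold adjNat
          split_ifs <;> omega
  · apply F.eq_zero
    intro hle
    apply h
    constructor
    · obtain ⟨j, hj, hx⟩ := hle.exists_le 0
      have hj0 : j = 0 := Fin.le_zero_iff.1 hj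
      have : v 0 = 0 := (posMin_eq_iff v 0).1 hv0.symm
      rw [hj0, this, Fin.le_zero_iff] at hx
      exact ((posMin_eq_iff x 0).2 hx).symm
    · obtain ⟨j, hj, hx⟩ := hle.exists_le (x.symm (Fin.last _))
      rw [Equiv.apply_symm_apply, Fin.last_le_iff] at hx
      have h2 := (posMax_eq_iff v j).2 hx
      rw [Fin.le_def] at hj
      unfold posMax at h2 hv1 ⊢
      omega

lemma P_zero_left (m : ℕ) : ∀ (b : ℕ), 1 ≤ b → b + m = l + 1 →
    ∀ v : Equiv.Perm (Fin (l + 2)), DecreasingOff v 0 b → ∀ x : Equiv.Perm (Fin (l + 2)),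
    F.P x v = if posMin x = 0 ∧ b ≤ posMax x then 1 else 0 := by
  induction m using Nat.strong_induction_on with
  | _ m ih =>
    intro b hb hbm w hw x
    rcases Nat.eq_zero_or_pos m with hm | hm
    · obtain rfl : b = l + 1 := by omega
      exact F.P_zero_last hw x
    have hi : b + 1 < l + 2 := by omega
    have hv : DecreasingOff (w * adj b hi) 0 (b + 1) := by
      have := hw.mul_adj (by omega) b hi (by omega)
      simpa [adjNat, show 0 ≠ b by omega] using this
    have hPv := ih (m - 1) (by omega) (b + 1) (by omega) (by omega) _ hv
    have hlt : invLen (w * adj b hi) < invLen (w * adj b hi * adj b hi) := by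
      rw [adj_mul_adj, hw.descent_iff]
      omega
    have hcl : ∀ z, invLen (z * adj b hi) < invLen z → klmu F.P z (w * adj b hi) ≠ 0 →
        b + 2 < l + 2 ∧ DecreasingOff z 0 (b + 2) := by
      intro z hz hk
      have hd := pos_of_descent hz
      have hz1 : posMin z = 0 ∧ b + 1 ≤ posMax z := by
        by_contra hc
        exact hk (F.klmu_of_eq_zero (by rw [hPv, if_neg hc]))
      rw [F.klmu_of_eq_one (by rw [hPv, if_pos hz1])] at hk
      have hlen : invLen (w * adj b hi) = invLen z + 1 := by
        by_contra hc
        exact hk (if_neg hc)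
      have h1 := invLen_add_le hv (by omega) (by omega) z
      have h2 := posMax_lt z
      rw [hz1.1, if_pos (by omega), if_pos (by omega)] at h1
      have h3 : posMax z = b + 2 := by omega
      have := decreasingOff_of_le_invLen_add hv (by omega) (by omega) (z := z) (by
        rw [hz1.1, if_pos (by omega), if_pos (by omega)]
        omega)
      rw [hz1.1, h3] at this
      exact ⟨by omega, this⟩
    have hp := posMin_ne_posMax x
    have hpm := posMax_lt x
    by_cases hb2 : b + 2 < l + 2
    · have hu : DecreasingOff (w * adj b hi * adj (b + 1) hb2) 0 (b + 2) := by
        have := hv.mul_adj (by omega) (b + 1) hb2 (by omega)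
        simpa [adjNat] using this
      have hPu := ih (m - 2) (by omega) (b + 2) (by omega) (by omega) _ hu
      have hlen := hv.invLen_eq hu (by omega) (by omega) (by omega) (by omega)
      have hlenw := hv.invLen_eq hw (by omega) (by omega) (by omega) (by omega)
      rw [if_pos (by omega), if_pos (by omega)] at hlen hlenw
      have h := F.P_mul_adj (w * adj b hi) b hi hlt {w * adj b hi * adj (b + 1) hb2}
        (fun z hz hk => by
          rw [Finset.mem_singleton]
          exact (hcl z hz hk).2.unique hu)
        (fun z hz => by
          rw [Finset.mem_singleton] at hz
          subst hz
          refine ⟨(hu.descent_iff b hi).2 (by omega), ?_, ?_⟩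
          · rw [F.klmu_of_eq_one, if_pos (by omega)]
            rw [hPv, if_pos]
            rw [hu.posMin_eq (by omega) (by omega), hu.posMax_eq (by omega) (by omega)]
            omega
          · rw [adj_mul_adj]
            omega) x
      rw [adj_mul_adj, Finset.sum_singleton, hPv, hPv, hPu, posMin_mul_adj, posMax_mul_adj] at h
      rw [h]
      unfold adjNat
      by_cases hd : invLen (x * adj b hi) < invLen x
      · have := pos_of_descent hd
        simp only [if_pos hd]
        split_ifs <;> first | omega | ring1
      · have := pos_of_not_descent hd
        simp only [if_neg hd]
        split_ifs <;> first | omega | ring1 | tauto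
    · have h := F.P_mul_adj (w * adj b hi) b hi hlt ∅
        (fun z hz hk => absurd (hcl z hz hk).1 hb2) (fun z hz => by simp at hz) x
      rw [adj_mul_adj, Finset.sum_empty, hPv, hPv, posMin_mul_adj, posMax_mul_adj] at h
      rw [h]
      unfold adjNat
      by_cases hd : invLen (x * adj b hi) < invLen x
      · have := pos_of_descent hd
        simp only [if_pos hd]
        split_ifs <;> first | omega | ring1
      · have := pos_of_not_descent hd
        simp only [if_neg hd]
        split_ifs <;> first | omega | ring1

lemma P_one_two {v : Equiv.Perm (Fin (l + 2))} (hl : 2 ≤ l) (hw : DecreasingOff v 1 2)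
    (x : Equiv.Perm (Fin (l + 2))) :
    F.P x v = if posMin x ≤ 1 ∧ 2 ≤ posMax x then 1 else 0 := by
  have hi : 0 + 1 < l + 2 := by omega
  have hv : DecreasingOff (v * adj 0 hi) 0 2 := hw.mul_adj (by omega) 0 hi (by omega)
  have hPv := F.P_zero_left (l - 1) 2 (by omega) (by omega) _ hv
  have h := F.P_mul_adj (v * adj 0 hi) 0 hi
    (by rw [adj_mul_adj, hw.descent_iff]; omega) ∅
    (fun z hz hk => by
      have hd := pos_of_descent hz
      exact absurd (F.klmu_of_eq_zero (by rw [hPv, if_neg (by omega)])) hk)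
    (fun z hz => by simp at hz) x
  rw [adj_mul_adj, Finset.sum_empty, hPv, hPv, posMin_mul_adj, posMax_mul_adj] at h
  rw [h]
  have hp := posMin_ne_posMax x
  unfold adjNat
  by_cases hd : invLen (x * adj 0 hi) < invLen x
  · have := pos_of_descent hd
    simp only [if_pos hd]
    split_ifs <;> first | omega | ring1
  · have := pos_of_not_descent hd
    simp only [if_neg hd]
    split_ifs <;> first | omega | ring1 | tauto

lemma P_two_one {v : Equiv.Perm (Fin (l + 2))} (hl : 2 ≤ l) (hw : DecreasingOff v 2 1)
    (x : Equiv.Perm (Fin (l + 2))) :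
    F.P x v = if posMin x ≤ 2 ∧ 1 ≤ posMax x then
      1 + (if posMin x = 0 ∧ 3 ≤ posMax x then Polynomial.X else 0) else 0 := by
  have hi : 1 + 1 < l + 2 := by omega
  have hv : DecreasingOff (v * adj 1 hi) 1 2 := hw.mul_adj (by omega) 1 hi (by omega)
  have hPv := F.P_one_two hl hv
  have h := F.P_mul_adj (v * adj 1 hi) 1 hi
    (by rw [adj_mul_adj, hw.descent_iff]; omega) ∅
    (fun z hz hk => by
      have hd := pos_of_descent hz
      have hz1 : posMin z ≤ 1 ∧ 2 ≤ posMax z := by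
        by_contra hc
        exact hk (F.klmu_of_eq_zero (by rw [hPv, if_neg hc]))
      rw [F.klmu_of_eq_one (by rw [hPv, if_pos hz1])] at hk
      have hlen : invLen (v * adj 1 hi) = invLen z + 1 := by
        by_contra hc
        exact hk (if_neg hc)
      have h1 := invLen_add_le hv (by omega) (by omega) z
      rw [if_pos (by omega), if_pos (by omega)] at h1
      omega)
    (fun z hz => by simp at hz) x
  rw [adj_mul_adj, Finset.sum_empty, hPv, hPv, posMin_mul_adj, posMax_mul_adj] at h
  rw [h]
  have hp := posMin_ne_posMax x
  unfold adjNat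
  by_cases hd : invLen (x * adj 1 hi) < invLen x
  · have := pos_of_descent hd
    simp only [if_pos hd]
    split_ifs <;> first | omega | ring1
  · have := pos_of_not_descent hd
    simp only [if_neg hd]
    split_ifs <;> first | omega | ring1

/-- The value of `P x v` when `v` has its minimum at position `j` and its maximum at `1`. -/
noncomputable def cone (j a b : ℕ) : Polynomial ℤ :=
  if a ≤ j ∧ 1 ≤ b then 1 + (if a = 0 ∧ j + 1 ≤ b then Polynomial.X ^ (j - 1) else 0) else 0

lemma cone_cases (k a b : ℕ) :
    ((k + 1 < a ∨ b < 1) ∧ cone (k + 1) a b = 0) ∨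
      ((a ≤ k + 1 ∧ 1 ≤ b ∧ (a ≠ 0 ∨ b ≤ k + 1)) ∧ cone (k + 1) a b = 1) ∨
      ((a = 0 ∧ k + 2 ≤ b) ∧ cone (k + 1) a b = 1 + Polynomial.X ^ k) := by
  unfold cone
  split_ifs with h1 h2
  · exact Or.inr (Or.inr ⟨by omega, rfl⟩)
  · exact Or.inr (Or.inl ⟨by omega, by ring⟩)
  · exact Or.inl ⟨by omega, rfl⟩

lemma adjNat_cases (i a : ℕ) :
    (a = i ∧ adjNat i a = i + 1) ∨ (a = i + 1 ∧ adjNat i a = i) ∨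
      (a ≠ i ∧ a ≠ i + 1 ∧ adjNat i a = a) := by
  unfold adjNat
  split_ifs <;> omega

lemma cone_three {a b : ℕ} (hab : a ≠ b) {c : Prop} [Decidable c]
    (hc : c → a ≠ 2 ∧ b ≠ 2 + 1) (hc' : ¬ c → a ≠ 2 + 1 ∧ b ≠ 2) :
    (if c then Polynomial.X else 1) * cone 2 a b +
        (if c then 1 else Polynomial.X) * cone 2 (adjNat 2 a) (adjNat 2 b) -
      (Polynomial.X * (if a ≤ 1 ∧ 2 ≤ b then 1 else 0) +
        Polynomial.X * (if a = 0 ∧ 1 ≤ b then 1 else 0)) = cone 3 a b := by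
  have ha := adjNat_cases 2 a
  have hb := adjNat_cases 2 b
  generalize adjNat 2 a = a' at ha ⊢
  generalize adjNat 2 b = b' at hb ⊢
  have hcc : (c ∧ a ≠ 2 ∧ b ≠ 3) ∨ (¬ c ∧ a ≠ 3 ∧ b ≠ 2) := by tauto
  clear hc hc'
  rcases cone_cases 1 a b with ⟨h1, e1⟩ | ⟨h1, e1⟩ | ⟨h1, e1⟩ <;>
  rcases cone_cases 2 a b with ⟨h2, e2⟩ | ⟨h2, e2⟩ | ⟨h2, e2⟩ <;>
  try (exfalso; omega)
  all_goals
    rcases cone_cases 1 a' b' with ⟨h3, e3⟩ | ⟨h3, e3⟩ | ⟨h3, e3⟩ <;>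
    rcases hcc with ⟨h4, h5⟩ | ⟨h4, h5⟩ <;>
    try (exfalso; omega)
  all_goals
    rw [e1, e2, e3]
    simp only [h4, if_true, if_false]
    split_ifs <;> first | ring1 | (exfalso; omega)

lemma cone_add_four {t a b : ℕ} {c : Prop} [Decidable c]
    (hc : c → a ≠ t + 3 ∧ b ≠ t + 3 + 1) (hc' : ¬ c → a ≠ t + 3 + 1 ∧ b ≠ t + 3) :
    (if c then Polynomial.X else 1) * cone (t + 3) a b +
        (if c then 1 else Polynomial.X) *
          cone (t + 3) (adjNat (t + 3) a) (adjNat (t + 3) b) -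
      Polynomial.X * cone (t + 2) a b = cone (t + 4) a b := by
  have ha := adjNat_cases (t + 3) a
  have hb := adjNat_cases (t + 3) b
  generalize adjNat (t + 3) a = a' at ha ⊢
  generalize adjNat (t + 3) b = b' at hb ⊢
  have hcc : (c ∧ a ≠ t + 3 ∧ b ≠ t + 4) ∨ (¬ c ∧ a ≠ t + 4 ∧ b ≠ t + 3) := by tauto
  clear hc hc'
  rcases cone_cases (t + 2) a b with ⟨h1, e1⟩ | ⟨h1, e1⟩ | ⟨h1, e1⟩ <;>
  rcases cone_cases (t + 3) a b with ⟨h2, e2⟩ | ⟨h2, e2⟩ | ⟨h2, e2⟩ <;>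
  try (exfalso; omega)
  all_goals
    rcases cone_cases (t + 1) a b with ⟨h0, e0⟩ | ⟨h0, e0⟩ | ⟨h0, e0⟩ <;>
    rcases cone_cases (t + 2) a' b' with ⟨h3, e3⟩ | ⟨h3, e3⟩ | ⟨h3, e3⟩ <;>
    rcases hcc with ⟨h4, h5⟩ | ⟨h4, h5⟩ <;>
    try (exfalso; omega)
  all_goals
    rw [e0, e1, e2, e3]
    simp only [h4, if_true, if_false]
    ring1

lemma klmu_cone {j : ℕ} (hj : 2 ≤ j) (hjl : j + 1 < l + 2) {v : Equiv.Perm (Fin (l + 2))}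
    (hv : DecreasingOff v j 1) (hP : ∀ x, F.P x v = cone j (posMin x) (posMax x))
    {z : Equiv.Perm (Fin (l + 2))} (hz : invLen (z * adj j hjl) < invLen z) :
    klmu F.P z v =
      if posMin z ≤ j ∧ 1 ≤ posMax z ∧ invLen v = invLen z + 1 then 1 else 0 := by
  have hd := pos_of_descent hz
  have hlen := invLen_add_le hv (by omega) (by omega) z
  unfold klmu
  rw [hP, cone]
  by_cases h1 : posMin z ≤ j ∧ 1 ≤ posMax z
  · rw [if_pos h1]
    by_cases h2 : posMin z = 0 ∧ j + 1 ≤ posMax z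
    · rw [if_pos h2, Polynomial.coeff_add, Polynomial.coeff_one, Polynomial.coeff_X_pow]
      rw [if_neg (by omega), if_pos (by omega)] at hlen
      split_ifs <;> omega
    · rw [if_neg h2, add_zero, Polynomial.coeff_one]
      split_ifs <;> omega
  · rw [if_neg h1, if_neg (show ¬ (posMin z ≤ j ∧ 1 ≤ posMax z ∧ _) from
      fun h => h1 ⟨h.1, h.2.1⟩)]
    simp

lemma pos_of_klmu_cone {j : ℕ} (hj : 2 ≤ j) (hjl : j + 1 < l + 2)
    {v : Equiv.Perm (Fin (l + 2))} (hv : DecreasingOff v j 1)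
    (hP : ∀ x, F.P x v = cone j (posMin x) (posMax x))
    {z : Equiv.Perm (Fin (l + 2))} (hz : invLen (z * adj j hjl) < invLen z)
    (hk : klmu F.P z v ≠ 0) :
    (j = 2 ∧ (DecreasingOff z 0 1 ∨ DecreasingOff z 1 2)) ∨
      (3 ≤ j ∧ DecreasingOff z (j - 1) 1) := by
  rw [F.klmu_cone hj hjl hv hP hz] at hk
  have hd := pos_of_descent hz
  have hne := posMin_ne_posMax z
  obtain ⟨h1, h2, h3⟩ : posMin z ≤ j ∧ 1 ≤ posMax z ∧ invLen v = invLen z + 1 := by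
    by_contra hc
    exact hk (if_neg hc)
  have hlen := invLen_add_le hv (by omega) (by omega) z
  have heq := decreasingOff_of_le_invLen_add hv (by omega) (by omega) (z := z)
  rw [if_neg (show ¬ j < 1 by omega)] at hlen heq
  have hcases : (j = 2 ∧ ((posMin z = 0 ∧ posMax z = 1) ∨ (posMin z = 1 ∧ posMax z = 2))) ∨
      (3 ≤ j ∧ posMin z = j - 1 ∧ posMax z = 1) := by
    split_ifs at hlen <;> omega
  have hD : DecreasingOff z (posMin z) (posMax z) := by
    apply heq
    split_ifs <;> omega
  rcases hcases with ⟨h, ⟨h4, h5⟩ | ⟨h4, h5⟩⟩ | ⟨h, h4, h5⟩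
  · rw [h4, h5] at hD
    exact Or.inl ⟨h, Or.inl hD⟩
  · rw [h4, h5] at hD
    exact Or.inl ⟨h, Or.inr hD⟩
  · rw [h4, h5] at hD
    exact Or.inr ⟨h, hD⟩

lemma correction_cone {j a b : ℕ} (hj : 2 ≤ j) (hjl : j + 1 < l + 2)
    {v : Equiv.Perm (Fin (l + 2))} (hv : DecreasingOff v j 1)
    (hP : ∀ x, F.P x v = cone j (posMin x) (posMax x))
    (hvs : invLen (v * adj j hjl) = invLen v + 1)
    {u : Equiv.Perm (Fin (l + 2))} (hu : DecreasingOff u a b)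
    (hab : (j = 2 ∧ ((a = 0 ∧ b = 1) ∨ (a = 1 ∧ b = 2))) ∨ (3 ≤ j ∧ a = j - 1 ∧ b = 1)) :
    invLen (u * adj j hjl) < invLen u ∧ klmu F.P u v = 1 ∧
      invLen (v * adj j hjl) = invLen u + 2 := by
  have h1 : invLen (u * adj j hjl) < invLen u := (hu.descent_iff j hjl).2 (by omega)
  have hlen := hv.invLen_eq hu (by omega) (by omega) (by omega) (by omega)
  rw [if_neg (show ¬ j < 1 by omega)] at hlen
  have hlen' : invLen v = invLen u + 1 := by
    split_ifs at hlen <;> omega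
  refine ⟨h1, ?_, by omega⟩
  rw [F.klmu_cone hj hjl hv hP h1, hu.posMin_eq (by omega) (by omega),
    hu.posMax_eq (by omega) (by omega), if_pos (by omega)]

lemma P_three_one {w : Equiv.Perm (Fin (l + 2))} (hl : 3 ≤ l) (hw : DecreasingOff w 3 1)
    (x : Equiv.Perm (Fin (l + 2))) : F.P x w = cone 3 (posMin x) (posMax x) := by
  have hi : 2 + 1 < l + 2 := by omega
  have hv : DecreasingOff (w * adj 2 hi) 2 1 := hw.mul_adj (by omega) 2 hi (by omega)
  have hPv : ∀ x, F.P x (w * adj 2 hi) = cone 2 (posMin x) (posMax x) := fun x => by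
    rw [F.P_two_one (by omega) hv, cone]
    simp
  have h1 : 1 + 1 < l + 2 := by omega
  have h0 : 0 + 1 < l + 2 := by omega
  have hu : DecreasingOff (w * adj 2 hi * adj 1 h1) 1 2 :=
    hv.mul_adj (by omega) 1 h1 (by omega)
  have hy : DecreasingOff (w * adj 2 hi * adj 1 h1 * adj 0 h0 * adj 1 h1) 0 1 :=
    (hu.mul_adj (by omega) 0 h0 (by omega)).mul_adj (by decide) 1 h1 (by decide)
  have hPu := F.P_one_two (by omega) hu
  have hPy := F.P_zero_left l 1 (by omega) (by omega) _ hy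
  generalize w * adj 2 hi * adj 1 h1 * adj 0 h0 * adj 1 h1 = y at hy hPy
  generalize w * adj 2 hi * adj 1 h1 = u at hu hPu
  have huy : u ≠ y := by
    rintro rfl
    have := hu.posMin_eq (by omega) (by omega)
    rw [hy.posMin_eq (by omega) (by omega)] at this
    omega
  have hlw := hv.invLen_eq hw (by omega) (by omega) (by omega) (by omega)
  rw [if_neg (by omega), if_neg (by omega)] at hlw
  have hvs : invLen (w * adj 2 hi * adj 2 hi) = invLen (w * adj 2 hi) + 1 := by
    rw [adj_mul_adj]
    omega
  have h := F.P_mul_adj (w * adj 2 hi) 2 hi (by omega) {u, y}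
    (fun z hz hk => by
      rw [Finset.mem_insert, Finset.mem_singleton]
      rcases F.pos_of_klmu_cone le_rfl hi hv hPv hz hk with ⟨-, h | h⟩ | ⟨h, -⟩
      · exact Or.inr (h.unique hy)
      · exact Or.inl (h.unique hu)
      · omega)
    (fun z hz => by
      rw [Finset.mem_insert, Finset.mem_singleton] at hz
      rcases hz with rfl | rfl
      · exact F.correction_cone le_rfl hi hv hPv hvs hu (by omega)
      · exact F.correction_cone le_rfl hi hv hPv hvs hy (by omega)) x
  rw [adj_mul_adj, Finset.sum_pair huy, hPv, hPv, hPu, hPy, posMin_mul_adj, posMax_mul_adj] at h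
  rw [h]
  have hp := posMin_ne_posMax x
  have hd := fun hd => pos_of_descent (x := x) (i := 2) (hi := hi) hd
  have hd' := fun hd => pos_of_not_descent (x := x) (i := 2) (hi := hi) hd
  exact cone_three hp hd hd'

lemma P_eq_cone (j : ℕ) (hj : 2 ≤ j) (hjl : j ≤ l) {w : Equiv.Perm (Fin (l + 2))}
    (hw : DecreasingOff w j 1) (x : Equiv.Perm (Fin (l + 2))) :
    F.P x w = cone j (posMin x) (posMax x) := by
  induction j using Nat.strong_induction_on generalizing w x with
  | _ j ih =>
    rcases (show j = 2 ∨ j = 3 ∨ 4 ≤ j by omega) with rfl | rfl | h4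
    · rw [F.P_two_one hjl hw, cone]
      simp
    · exact F.P_three_one hjl hw x
    obtain ⟨t, rfl⟩ : ∃ t, j = t + 4 := ⟨j - 4, by omega⟩
    have hi : t + 3 + 1 < l + 2 := by omega
    have h1 : t + 2 + 1 < l + 2 := by omega
    have hv : DecreasingOff (w * adj (t + 3) hi) (t + 3) 1 := by
      have := hw.mul_adj (by omega) (t + 3) hi (by omega)
      simpa [adjNat] using this
    have hu : DecreasingOff (w * adj (t + 3) hi * adj (t + 2) h1) (t + 2) 1 := by
      have := hv.mul_adj (by omega) (t + 2) h1 (by omega)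
      simpa [adjNat] using this
    have hPv := fun x => ih (t + 3) (by omega) (by omega) (by omega) hv x
    have hPu := fun x => ih (t + 2) (by omega) (by omega) (by omega) hu x
    generalize w * adj (t + 3) hi * adj (t + 2) h1 = u at hu hPu
    have hlw := hv.invLen_eq hw (by omega) (by omega) (by omega) (by omega)
    rw [if_neg (by omega), if_neg (by omega)] at hlw
    have hvs : invLen (w * adj (t + 3) hi * adj (t + 3) hi)
        = invLen (w * adj (t + 3) hi) + 1 := by
      rw [adj_mul_adj]
      omega
    have h := F.P_mul_adj (w * adj (t + 3) hi) (t + 3) hi (by omega) {u}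
      (fun z hz hk => by
        rw [Finset.mem_singleton]
        rcases F.pos_of_klmu_cone (by omega) hi hv hPv hz hk with ⟨h, -⟩ | ⟨-, h⟩
        · omega
        · exact h.unique hu)
      (fun z hz => by
        rw [Finset.mem_singleton] at hz
        subst hz
        exact F.correction_cone (by omega) hi hv hPv hvs hu (by omega)) x
    rw [adj_mul_adj, Finset.sum_singleton, hPv, hPv, hPu, posMin_mul_adj, posMax_mul_adj] at h
    rw [h]
    have hd := fun hd => pos_of_descent (x := x) (i := t + 3) (hi := hi) hd
    have hd' := fun hd => pos_of_not_descent (x := x) (i := t + 3) (hi := hi) hd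
    exact cone_add_four hd hd'

end KLFamily

lemma decreasingOff_of_wklmVal {l : ℕ} (hl : 2 ≤ l) {w : Equiv.Perm (Fin (l + 2))}
    (hw : ∀ i : Fin (l + 2), (w i : ℕ) = wklmVal 1 l 1 (i : ℕ)) : DecreasingOff w l 1 := by
  intro p q hpq
  rw [Fin.lt_def] at hpq
  have hp := p.2
  have hq := q.2
  rw [Fin.lt_def, hw, hw]
  unfold wklmVal
  split_ifs <;> omega

/-- For `l ≥ 2` and any Kazhdan–Lusztig family `P` for `S_{l+2}`,
`P_{x_{1,l,1}, w_{1,l,1}} = 1 + q^{l−1}`. -/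
theorem kl_45312 (l : ℕ) (hl : 2 ≤ l) (F : KLFamily (l + 2))
    (x w : Equiv.Perm (Fin (l + 2)))
    (hx : ∀ i : Fin (l + 2), (x i : ℕ) = xklmVal 1 l 1 (i : ℕ))
    (hw : ∀ i : Fin (l + 2), (w i : ℕ) = wklmVal 1 l 1 (i : ℕ)) :
    F.P x w = 1 + Polynomial.X ^ (l - 1) := by
  have h0 : posMin x = 0 := by
    refine ((posMin_eq_iff x 0).2 (Fin.ext ?_)).symm
    rw [hx]
    simp [xklmVal]
  have h1 : posMax x = l + 1 := by
    refine ((posMax_eq_iff x (Fin.last (l + 1))).2 (Fin.ext ?_)).symm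
    rw [hx, Fin.val_last]
    unfold xklmVal
    split_ifs <;> omega
  rw [F.P_eq_cone l hl le_rfl (decreasingOff_of_wklmVal hl hw) x, h0, h1, KLFamily.cone,
    if_pos (by omega), if_pos (by omega)]

end BSW
end

section
/- If x ∈ S_n is a maximal singular point (MSP) for w ∈ S_n, then the flattened permutation x̃ avoids both the pattern 231 and the pattern 312. -/
open scoped Classical

namespace BSW

/-- A set of lattice points together with an integer labelling of the unit cells: the cell
`(p, q)` is the one with lower left corner `(p, q)`. -/
@[ext]
structure Config where
  /-- the points -/
  S : ℤ × ℤ → Prop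
  /-- the labels of the cells -/
  d : ℤ → ℤ → ℤ

namespace Config

/-- Two points in north-east position spanning a rectangle with positive labels. -/
structure Edge (c : Config) (A B : ℤ × ℤ) : Prop where
  left : c.S A
  right : c.S B
  lt₁ : A.1 < B.1
  lt₂ : A.2 < B.2
  free : ∀ p q, A.1 ≤ p → p < B.1 → A.2 ≤ q → q < B.2 → 1 ≤ c.d p q

/-- Two edges without common endpoint whose rectangles share a cell with label at most one. -/
structure Crossing (c : Config) (A B C D : ℤ × ℤ) : Prop where
  fst : c.Edge A B
  snd : c.Edge C D
  ne_left : A ≠ C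
  ne_right : B ≠ D
  cell : ∃ p q, A.1 ≤ p ∧ p < B.1 ∧ A.2 ≤ q ∧ q < B.2 ∧
    C.1 ≤ p ∧ p < D.1 ∧ C.2 ≤ q ∧ q < D.2 ∧ c.d p q ≤ 1

/-- Two consecutive edges such that both off-diagonal blocks of the rectangle they span contain
a cell whose label is not positive. -/
structure Chain (c : Config) (A B C : ℤ × ℤ) : Prop where
  fst : c.Edge A B
  snd : c.Edge B C
  upper : ∃ p q, A.1 ≤ p ∧ p < B.1 ∧ B.2 ≤ q ∧ q < C.2 ∧ c.d p q ≤ 0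
  lower : ∃ p q, B.1 ≤ p ∧ p < C.1 ∧ A.2 ≤ q ∧ q < B.2 ∧ c.d p q ≤ 0

/-- Exchange the heights of the two points `A` and `B`, lowering the labels in between. -/
def swap (c : Config) (A B : ℤ × ℤ) : Config where
  S X := (c.S X ∧ X ≠ A ∧ X ≠ B) ∨ X = (A.1, B.2) ∨ X = (B.1, A.2)
  d p q := c.d p q - if A.1 ≤ p ∧ p < B.1 ∧ A.2 ≤ q ∧ q < B.2 then 1 else 0

/-- Rotation by a half turn. -/
def rot (c : Config) : Config where
  S X := c.S (-X)
  d p q := c.d (-p - 1) (-q - 1)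

/-- Reflection in the main diagonal. -/
def tr (c : Config) : Config where
  S X := c.S X.swap
  d p q := c.d q p

/-- The properties of the configuration of a maximal singular point used below. -/
structure Good (c : Config) : Prop where
  inj₁ : ∀ A B, c.S A → c.S B → A.1 = B.1 → A = B
  inj₂ : ∀ A B, c.S A → c.S B → A.2 = B.2 → A = B
  exists_point : ∀ p q p' q', p < p' → q' < q → c.d p' q' + c.d p q < c.d p q' + c.d p' q →
    ∃ X, c.S X ∧ p < X.1 ∧ X.1 ≤ p' ∧ q' < X.2 ∧ X.2 ≤ q
  conflict : ∀ A B, c.Edge A B → (∃ C D, c.Crossing A B C D) ∨ (∃ C, c.Chain A B C) ∨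
    ∃ C, c.Chain C A B
  not_crossing : ∀ {A B}, c.Edge A B → ∀ P Q X Y, ¬ (c.swap A B).Crossing P Q X Y
  not_chain : ∀ {A B}, c.Edge A B → ∀ X Y Z, ¬ (c.swap A B).Chain X Y Z

variable {c : Config} {A B C D E P Q X Y Z : ℤ × ℤ}

lemma swap_d_le (p q : ℤ) : (c.swap A B).d p q ≤ c.d p q := by
  simp only [swap]; split_ifs <;> omega

lemma swap_edge (hX : (c.swap A B).S X) (hY : (c.swap A B).S Y) (h₁ : X.1 < Y.1)
    (h₂ : X.2 < Y.2) (h : ∀ p q, X.1 ≤ p → p < Y.1 → X.2 ≤ q → q < Y.2 →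
      1 ≤ c.d p q ∧ (A.1 ≤ p → p < B.1 → A.2 ≤ q → q < B.2 → 2 ≤ c.d p q)) :
    (c.swap A B).Edge X Y := by
  refine ⟨hX, hY, h₁, h₂, fun p q a b e f => ?_⟩
  obtain ⟨u, v⟩ := h p q a b e f
  simp only [swap]
  split_ifs with g
  · have := v g.1 g.2.1 g.2.2.1 g.2.2.2; omega
  · omega

lemma swap_upper : (c.swap A B).S (A.1, B.2) := Or.inr (Or.inl rfl)

lemma swap_lower : (c.swap A B).S (B.1, A.2) := Or.inr (Or.inr rfl)

lemma swap_of_ne (h : c.S X) (hA : X ≠ A) (hB : X ≠ B) : (c.swap A B).S X :=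
  Or.inl ⟨h, hA, hB⟩

lemma rot_edge : c.rot.Edge A B ↔ c.Edge (-B) (-A) := by
  constructor
  · rintro ⟨h₁, h₂, h₃, h₄, h₅⟩
    refine ⟨h₂, h₁, by simpa using h₃, by simpa using h₄, fun p q a b e f => ?_⟩
    simp only [Prod.fst_neg, Prod.snd_neg] at a b e f
    have := h₅ (-p - 1) (-q - 1) (by omega) (by omega) (by omega) (by omega)
    simp only [rot] at this
    convert this using 2 <;> ring
  · rintro ⟨h₁, h₂, h₃, h₄, h₅⟩
    refine ⟨h₂, h₁, by simpa using h₃, by simpa using h₄, fun p q a b e f => ?_⟩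
    simp only [Prod.fst_neg, Prod.snd_neg] at h₅
    exact h₅ (-p - 1) (-q - 1) (by omega) (by omega) (by omega) (by omega)

lemma rot_rot : c.rot.rot = c := by
  simp [rot]

lemma Crossing.rot (h : c.Crossing A B C D) : c.rot.Crossing (-B) (-A) (-D) (-C) := by
  obtain ⟨h₁, h₂, h₃, h₄, p, q, h⟩ := h
  refine ⟨by simpa [rot_edge] using h₁, by simpa [rot_edge] using h₂, by simpa using h₄,
    by simpa using h₃, -p - 1, -q - 1, ?_⟩
  have : c.rot.d (-p - 1) (-q - 1) = c.d p q := by simp [Config.rot]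
  simp only [Prod.fst_neg, Prod.snd_neg]
  omega

lemma Chain.rot (h : c.Chain A B C) : c.rot.Chain (-C) (-B) (-A) := by
  obtain ⟨h₁, h₂, ⟨p, q, h⟩, ⟨p', q', h'⟩⟩ := h
  have : c.rot.d (-p - 1) (-q - 1) = c.d p q := by simp [Config.rot]
  have : c.rot.d (-p' - 1) (-q' - 1) = c.d p' q' := by simp [Config.rot]
  refine ⟨by simpa [rot_edge] using h₂, by simpa [rot_edge] using h₁, ⟨-p' - 1, -q' - 1, ?_⟩,
    ⟨-p - 1, -q - 1, ?_⟩⟩ <;>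
  simp only [Prod.fst_neg, Prod.snd_neg] <;> omega

lemma rot_crossing : c.rot.Crossing A B C D ↔ c.Crossing (-B) (-A) (-D) (-C) :=
  ⟨fun h => by simpa [rot_rot] using h.rot, fun h => by simpa using h.rot⟩

lemma rot_chain : c.rot.Chain A B C ↔ c.Chain (-C) (-B) (-A) :=
  ⟨fun h => by simpa [rot_rot] using h.rot, fun h => by simpa using h.rot⟩

lemma rot_swap : c.rot.swap A B = (c.swap (-B) (-A)).rot := by
  ext X Y
  · simp only [swap, rot, Prod.ext_iff, Prod.fst_neg, Prod.snd_neg, ne_eq, neg_inj]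
    tauto
  · simp only [swap, rot, Prod.fst_neg, Prod.snd_neg]
    congr 1
    refine if_congr ?_ rfl rfl
    omega

lemma tr_edge : c.tr.Edge A B ↔ c.Edge A.swap B.swap :=
  ⟨fun h => ⟨h.1, h.2, h.4, h.3, fun p q a b e f => h.5 q p e f a b⟩,
    fun h => ⟨h.1, h.2, h.4, h.3, fun p q a b e f => h.5 q p e f a b⟩⟩

lemma Crossing.tr (h : c.Crossing A B C D) : c.tr.Crossing A.swap B.swap C.swap D.swap := by
  obtain ⟨h₁, h₂, h₃, h₄, p, q, h⟩ := h
  refine ⟨tr_edge.2 h₁, tr_edge.2 h₂, by simpa using h₃, by simpa using h₄, q, p, ?_⟩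
  simp only [Prod.fst_swap, Prod.snd_swap, Config.tr]
  tauto

lemma Chain.tr (h : c.Chain A B C) : c.tr.Chain A.swap B.swap C.swap := by
  obtain ⟨h₁, h₂, ⟨p, q, h⟩, ⟨p', q', h'⟩⟩ := h
  refine ⟨tr_edge.2 h₁, tr_edge.2 h₂, ⟨q', p', ?_⟩, ⟨q, p, ?_⟩⟩ <;>
  simp only [Prod.fst_swap, Prod.snd_swap, Config.tr] <;> tauto

lemma tr_crossing : c.tr.Crossing A B C D ↔ c.Crossing A.swap B.swap C.swap D.swap :=
  ⟨fun h => h.tr, fun h => h.tr⟩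

lemma tr_chain : c.tr.Chain A B C ↔ c.Chain A.swap B.swap C.swap :=
  ⟨fun h => h.tr, fun h => h.tr⟩

lemma tr_swap : c.tr.swap A B = (c.swap A.swap B.swap).tr := by
  ext X Y
  · simp only [swap, tr, Prod.ext_iff, Prod.fst_swap, Prod.snd_swap, ne_eq]
    tauto
  · simp only [swap, tr, Prod.fst_swap, Prod.snd_swap]
    congr 1
    refine if_congr ?_ rfl rfl
    tauto

lemma Good.rot (h : c.Good) : c.rot.Good where
  inj₁ A B hA hB e := neg_injective (h.inj₁ _ _ hA hB (by simpa using e))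
  inj₂ A B hA hB e := neg_injective (h.inj₂ _ _ hA hB (by simpa using e))
  exists_point p q p' q' h₁ h₂ h₃ := by
    simp only [Config.rot] at h₃
    obtain ⟨X, hX, h⟩ := h.exists_point (-p' - 1) (-q' - 1) (-p - 1) (-q - 1) (by omega)
      (by omega) (by omega)
    refine ⟨-X, by simpa [Config.rot] using hX, ?_⟩
    simp only [Prod.fst_neg, Prod.snd_neg]
    omega
  conflict A B hAB := by
    rw [rot_edge] at hAB
    rcases h.conflict _ _ hAB with ⟨C, D, h⟩ | ⟨C, h⟩ | ⟨C, h⟩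
    · exact Or.inl ⟨-D, -C, by simpa using h.rot⟩
    · exact Or.inr (Or.inr ⟨-C, by simpa using h.rot⟩)
    · exact Or.inr (Or.inl ⟨-C, by simpa using h.rot⟩)
  not_crossing {A B} hAB P Q X Y := by
    rw [rot_swap, rot_crossing]
    exact h.not_crossing (rot_edge.1 hAB) _ _ _ _
  not_chain {A B} hAB X Y Z := by
    rw [rot_swap, rot_chain]
    exact h.not_chain (rot_edge.1 hAB) _ _ _

lemma Good.tr (h : c.Good) : c.tr.Good where
  inj₁ A B hA hB e := Prod.swap_injective (h.inj₂ _ _ hA hB e)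
  inj₂ A B hA hB e := Prod.swap_injective (h.inj₁ _ _ hA hB e)
  exists_point p q p' q' h₁ h₂ h₃ := by
    simp only [Config.tr] at h₃
    obtain ⟨X, hX, h⟩ := h.exists_point q' p' q p h₂ h₁ (by omega)
    exact ⟨X.swap, hX, h.2.2.1, h.2.2.2, h.1, h.2.1⟩
  conflict A B hAB := by
    rcases h.conflict _ _ (tr_edge.1 hAB) with ⟨C, D, h⟩ | ⟨C, h⟩ | ⟨C, h⟩
    · exact Or.inl ⟨C.swap, D.swap, h.tr⟩
    · exact Or.inr (Or.inl ⟨C.swap, h.tr⟩)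
    · exact Or.inr (Or.inr ⟨C.swap, h.tr⟩)
  not_crossing {A B} hAB P Q X Y := by
    rw [tr_swap, tr_crossing]
    exact h.not_crossing (tr_edge.1 hAB) _ _ _ _
  not_chain {A B} hAB X Y Z := by
    rw [tr_swap, tr_chain]
    exact h.not_chain (tr_edge.1 hAB) _ _ _

namespace Good

lemma ne₁ (hc : c.Good) (hA : c.S A) (hB : c.S B) (h : A ≠ B) : A.1 ≠ B.1 :=
  fun e => h (hc.inj₁ _ _ hA hB e)

lemma ne₂ (hc : c.Good) (hA : c.S A) (hB : c.S B) (h : A ≠ B) : A.2 ≠ B.2 :=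
  fun e => h (hc.inj₂ _ _ hA hB e)

end Good

lemma Crossing.symm (h : c.Crossing A B C D) : c.Crossing C D A B := by
  obtain ⟨h₁, h₂, h₃, h₄, p, q, h⟩ := h
  exact ⟨h₂, h₁, h₃.symm, h₄.symm, p, q, by tauto⟩

namespace Good

lemma not_lt_of_crossing (hc : c.Good) (h : c.Crossing A B C D) (h₁ : A.1 < C.1)
    (h₂ : A.2 < C.2) : False := by
  obtain ⟨⟨sA, sB, ab₁, ab₂, fAB⟩, ⟨sC, sD, cd₁, cd₂, fCD⟩, nAC, nBD, p, q, hz⟩ := h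
  have hAC : c.Edge A C := ⟨sA, sC, h₁, h₂, by grind⟩
  have hu := swap_d_le (c := c) (A := A) (B := C)
  have sB' : (c.swap A C).S B := swap_of_ne sB (by grind) (by grind)
  have sD' : (c.swap A C).S D := swap_of_ne sD (by grind) (by grind)
  have hUB : (c.swap A C).Edge (A.1, C.2) B :=
    swap_edge swap_upper sB' (by grind) (by grind) (by grind)
  have hLB : (c.swap A C).Edge (C.1, A.2) B :=
    swap_edge swap_lower sB' (by grind) (by grind) (by grind)
  have e₁ : ∃ p q, B.1 ≤ p ∧ p < D.1 ∧ A.2 ≤ q ∧ q < C.2 ∧ c.d p q ≤ 0 := by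
    by_contra! hn
    exact hc.not_crossing hAC (A.1, C.2) B (C.1, A.2) D ⟨hUB,
      swap_edge swap_lower sD' (by grind) (by grind) (by grind), by grind, nBD, p, q, by grind⟩
  have e₂ : ∃ p q, A.1 ≤ p ∧ p < C.1 ∧ B.2 ≤ q ∧ q < D.2 ∧ c.d p q ≤ 0 := by
    by_contra! hn
    exact hc.not_crossing hAC (C.1, A.2) B (A.1, C.2) D ⟨hLB,
      swap_edge swap_upper sD' (by grind) (by grind) (by grind), by grind, nBD, p, q, by grind⟩
  obtain ⟨p₁, q₁, hz₁⟩ := e₁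
  obtain ⟨p₂, q₂, hz₂⟩ := e₂
  have hCB : c.Edge C B := ⟨sC, sB, by grind, by grind, by grind⟩
  have hv := swap_d_le (c := c) (A := C) (B := B)
  exact hc.not_chain hCB A (B.1, C.2) D ⟨swap_edge (swap_of_ne sA (by grind) (by grind))
    swap_lower (by grind) (by grind) (by grind), swap_edge swap_lower
    (swap_of_ne sD (by grind) (by grind)) (by grind) (by grind) (by grind),
    ⟨p₂, q₂, by grind⟩, ⟨p₁, q₁, by grind⟩⟩

lemma left_of_crossing (hc : c.Good) (h : c.Crossing A B C D) :
    (A.1 < C.1 ∧ C.2 < A.2) ∨ (C.1 < A.1 ∧ A.2 < C.2) := by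
  have h₁ := hc.ne₁ h.fst.left h.snd.left h.ne_left
  have h₂ := hc.ne₂ h.fst.left h.snd.left h.ne_left
  have h₃ := hc.not_lt_of_crossing h
  have h₄ := hc.not_lt_of_crossing h.symm
  grind

lemma right_of_crossing (hc : c.Good) (h : c.Crossing A B C D) :
    (B.1 < D.1 ∧ D.2 < B.2) ∨ (D.1 < B.1 ∧ B.2 < D.2) := by
  have := hc.rot.left_of_crossing h.rot
  simp only [Prod.fst_neg, Prod.snd_neg] at this
  omega

lemma crossing_of_between (hc : c.Good) (h : c.Crossing A C X Y) (hB : c.S B)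
    (h₁ : A.1 < B.1) (h₂ : A.2 < B.2) (h₃ : B.1 < C.1) (h₄ : B.2 < C.2) :
    c.Crossing A B X Y := by
  have hl := hc.left_of_crossing h
  have hr := hc.right_of_crossing h
  obtain ⟨⟨sA, sC, ac₁, ac₂, fAC⟩, ⟨sX, sY, xy₁, xy₂, fXY⟩, nAX, nCY, p, q, hz⟩ := h
  have hAB : c.Edge A B := ⟨sA, hB, h₁, h₂, by grind⟩
  by_contra hn
  have hBX : B ≠ X := by grind
  have hBY : B ≠ Y := by grind
  have hd : ∀ p q, A.1 ≤ p → p < B.1 → A.2 ≤ q → q < B.2 →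
    X.1 ≤ p → p < Y.1 → X.2 ≤ q → q < Y.2 → 2 ≤ c.d p q := by
    intro p q _ _ _ _ _ _ _ _
    by_contra hlt
    exact hn ⟨hAB, ⟨sX, sY, xy₁, xy₂, fXY⟩, nAX, hBY, p, q, by omega⟩
  have hXY : (c.swap A B).Edge X Y := swap_edge (swap_of_ne sX nAX.symm hBX.symm)
    (swap_of_ne sY (by grind) hBY.symm) xy₁ xy₂ (by grind)
  have sC' : (c.swap A B).S C := swap_of_ne sC (by grind) (by grind)
  have hle := swap_d_le (c := c) (A := A) (B := B) p q
  by_cases hq : B.2 ≤ q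
  · exact hc.not_crossing hAB (A.1, B.2) C X Y ⟨swap_edge swap_upper sC' (by grind) (by grind)
      (by grind), hXY, by grind, nCY, p, q, by grind⟩
  · have hp : B.1 ≤ p := by
      by_contra hp
      have := hd p q
      grind
    exact hc.not_crossing hAB (B.1, A.2) C X Y ⟨swap_edge swap_lower sC' (by grind) (by grind)
      (by grind), hXY, by grind, nCY, p, q, by grind⟩

lemma not_between_of_chain (hc : c.Good) (h : c.Chain A C D) (hB : c.S B)
    (h₁ : A.1 < B.1) (h₂ : A.2 < B.2) (h₃ : B.1 < C.1) (h₄ : B.2 < C.2) : False := by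
  obtain ⟨⟨sA, sC, ac₁, ac₂, fAC⟩, ⟨_, sD, cd₁, cd₂, fCD⟩, ⟨p, q, hz⟩, ⟨p', q', hz'⟩⟩ := h
  have hAB : c.Edge A B := ⟨sA, hB, h₁, h₂, by grind⟩
  have hBC : c.Edge B C := ⟨hB, sC, h₃, h₄, by grind⟩
  have sC' : (c.swap A B).S C := swap_of_ne sC (by grind) (by grind)
  have sD' : (c.swap A B).S D := swap_of_ne sD (by grind) (by grind)
  have hCD : (c.swap A B).Edge C D := swap_edge sC' sD' cd₁ cd₂ (by grind)
  have hu := swap_d_le (c := c) (A := A) (B := B)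
  have e₁ : ∀ p q, B.1 ≤ p → p < C.1 → C.2 ≤ q → q < D.2 → 1 ≤ c.d p q := by
    intro r s _ _ _ _
    by_contra hlt
    refine hc.not_chain hAB (B.1, A.2) C D ⟨swap_edge swap_lower sC' (by grind) (by grind)
      (by grind), hCD, ⟨r, s, ?_⟩, ⟨p', q', ?_⟩⟩
    · grind
    · grind
  have e₂ : ∀ p q, C.1 ≤ p → p < D.1 → B.2 ≤ q → q < C.2 → 1 ≤ c.d p q := by
    intro r s _ _ _ _
    by_contra hlt
    refine hc.not_chain hAB (A.1, B.2) C D ⟨swap_edge swap_upper sC' (by grind) (by grind)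
      (by grind), hCD, ⟨p, q, ?_⟩, ⟨r, s, ?_⟩⟩
    · grind
    · grind
  have hBD : c.Edge B D := ⟨hB, sD, by omega, by omega, by grind⟩
  have hd : ∀ p q, B.1 ≤ p → p < C.1 → B.2 ≤ q → q < C.2 → 2 ≤ c.d p q := by
    intro r s _ _ _ _
    by_contra hlt
    exact hc.not_lt_of_crossing ⟨⟨sA, sC, ac₁, ac₂, fAC⟩, hBD, by grind, by grind, r, s, by grind⟩
      h₁ h₂
  have hu := swap_d_le (c := c) (A := B) (B := C)
  refine hc.not_chain hBC A (B.1, C.2) D ⟨swap_edge (swap_of_ne sA (by grind) (by grind))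
    swap_upper (by grind) (by grind) (by grind), swap_edge swap_upper
    (swap_of_ne sD (by grind) (by grind)) (by grind) (by grind) (by grind),
    ⟨p, q, ?_⟩, ⟨p', q', ?_⟩⟩
  · grind
  · grind

lemma not_between (hc : c.Good) (h : c.Edge A C) (hB : c.S B)
    (h₁ : A.1 < B.1) (h₂ : A.2 < B.2) (h₃ : B.1 < C.1) (h₄ : B.2 < C.2) : False := by
  have hB' : c.rot.S (-B) := by simpa [Config.rot] using hB
  rcases hc.conflict _ _ h with ⟨X, Y, h⟩ | ⟨D, h⟩ | ⟨D, h⟩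
  · have u := hc.crossing_of_between h hB h₁ h₂ h₃ h₄
    have v := hc.rot.crossing_of_between h.rot hB' (by simpa) (by simpa) (by simpa) (by simpa)
    rw [rot_crossing] at v
    simp only [neg_neg] at v
    have l₁ := hc.left_of_crossing u
    have l₂ := hc.left_of_crossing v
    have r₁ := hc.right_of_crossing u
    obtain ⟨p, q, hz⟩ := u.cell
    obtain ⟨p', q', hz'⟩ := v.cell
    grind
  · exact hc.not_between_of_chain h hB h₁ h₂ h₃ h₄
  · exact hc.rot.not_between_of_chain h.rot hB' (by simpa) (by simpa) (by simpa) (by simpa)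

/-- Two edges with a common left endpoint have incomparable right endpoints. -/
lemma right_of_edges (hc : c.Good) (h : c.Edge A B) (h' : c.Edge A D) (hne : B ≠ D) :
    (B.1 < D.1 ∧ D.2 < B.2) ∨ (D.1 < B.1 ∧ B.2 < D.2) := by
  have h₁ := hc.ne₁ h.right h'.right hne
  have h₂ := hc.ne₂ h.right h'.right hne
  have h₃ := hc.not_between h h'.right h'.lt₁ h'.lt₂
  have h₄ := hc.not_between h' h.right h.lt₁ h.lt₂
  grind

lemma edge_of_crossing_aux (hc : c.Good) (h : c.Crossing A B C D) (h₁ : A.1 < C.1)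
    (h₂ : C.2 < A.2) (h₃ : D.1 < B.1) (h₄ : B.2 < D.2) : c.Edge A D := by
  obtain ⟨⟨sA, sB, ab₁, ab₂, fAB⟩, ⟨sC, sD, cd₁, cd₂, fCD⟩, nAC, nBD, p₂, q₂, ho⟩ := h
  have key : ∀ k : ℕ, ∀ p q, A.1 ≤ p → p < C.1 → B.2 ≤ q → q < B.2 + k → q < D.2 →
      1 ≤ c.d p q := by
    intro k
    induction k with
    | zero => intro p q; grind
    | succ k ih =>
      intro p q g₁ g₂ g₃ g₄ g₅
      by_contra hz
      have i₁ := fAB p q₂ (by grind) (by grind) (by grind) (by grind)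
      have i₂ := fCD p₂ q (by grind) (by grind) (by grind) (by grind)
      obtain ⟨X, sX, x₁, x₂, x₃, x₄⟩ := hc.exists_point p q p₂ q₂ (by grind) (by grind) (by grind)
      have j₁ := hc.not_between ⟨sA, sB, ab₁, ab₂, fAB⟩ sX (by grind) (by grind) (by grind)
      have j₂ := fun h => hc.not_between ⟨sC, sD, cd₁, cd₂, fCD⟩ sX h (by grind) (by grind)
        (by grind)
      have n₁ := hc.ne₂ sX sB (by grind)
      have n₂ := hc.ne₁ sX sC (by grind)
      have hXC : X.1 < C.1 := by grind
      have hAX : c.Edge A X := ⟨sA, sX, by grind, by grind, fun r s _ _ _ _ => by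
        by_cases hs : s < B.2
        · exact fAB r s (by grind) (by grind) (by grind) (by grind)
        · exact ih r s (by grind) (by grind) (by grind) (by push_cast at g₄; grind) (by grind)⟩
      have hu := swap_d_le (c := c) (A := A) (B := X) p₂ q₂
      exact hc.not_crossing hAX (X.1, A.2) B C D ⟨swap_edge swap_lower
        (swap_of_ne sB (by grind) (by grind)) (by grind) (by grind) (by grind),
        swap_edge (swap_of_ne sC (by grind) (by grind)) (swap_of_ne sD (by grind) (by grind))
        (by grind) (by grind) (by grind), by grind, nBD, p₂, q₂, by grind⟩
  refine ⟨sA, sD, by grind, by grind, fun p q _ _ _ _ => ?_⟩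
  by_cases hq : q < B.2
  · exact fAB p q (by grind) (by grind) (by grind) (by grind)
  by_cases hp : C.1 ≤ p
  · exact fCD p q (by grind) (by grind) (by grind) (by grind)
  exact key (q - B.2 + 1).toNat p q (by grind) (by grind) (by grind) (by grind) (by grind)

lemma edge_of_crossing (hc : c.Good) (h : c.Crossing A B C D) : c.Edge A D := by
  have hl := hc.left_of_crossing h
  have hr := hc.right_of_crossing h
  rcases hl with hl | hl <;> rcases hr with hr | hr
  · obtain ⟨⟨sA, sB, ab₁, ab₂, fAB⟩, ⟨sC, sD, cd₁, cd₂, fCD⟩, nAC, nBD, p, q, hz⟩ := h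
    exact ⟨sA, sD, by grind, by grind, by grind⟩
  · exact hc.edge_of_crossing_aux h hl.1 hl.2 hr.1 hr.2
  · have := hc.tr.edge_of_crossing_aux h.tr hl.2 hl.1 hr.2 hr.1
    simpa [tr_edge] using this
  · obtain ⟨⟨sA, sB, ab₁, ab₂, fAB⟩, ⟨sC, sD, cd₁, cd₂, fCD⟩, nAC, nBD, p, q, hz⟩ := h
    exact ⟨sA, sD, by grind, by grind, by grind⟩

variable {F : ℤ × ℤ}

lemma crossing_of_edge (hc : c.Good) (h : c.Crossing A B C D) (hE : c.Edge A E) (hne : E ≠ D) :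
    c.Crossing A E C D := by
  by_cases hEB : B = E
  · exact hEB ▸ h
  have hr := hc.right_of_edges h.fst hE hEB
  have hl := hc.left_of_crossing h
  obtain ⟨⟨sA, sB, ab₁, ab₂, fAB⟩, ⟨sC, sD, cd₁, cd₂, fCD⟩, nAC, nBD, p, q, hz⟩ := h
  by_contra hn
  have hd : ∀ p q, A.1 ≤ p → p < E.1 → A.2 ≤ q → q < E.2 →
      C.1 ≤ p → p < D.1 → C.2 ≤ q → q < D.2 → 2 ≤ c.d p q := by
    intro p q _ _ _ _ _ _ _ _
    by_contra hlt
    exact hn ⟨hE, ⟨sC, sD, cd₁, cd₂, fCD⟩, nAC, hne, p, q, by omega⟩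
  have hu := swap_d_le (c := c) (A := A) (B := E) p q
  have hlt := hE.lt₁
  have hlt' := hE.lt₂
  have sB' : (c.swap A E).S B := swap_of_ne sB (by grind) (by grind)
  have hCD : (c.swap A E).Edge C D := swap_edge (swap_of_ne sC (by grind) (by grind))
    (swap_of_ne sD (by grind) (by grind)) cd₁ cd₂ (by grind)
  have n₁ := hc.ne₁ sA sC nAC
  have n₂ := hc.ne₂ sA sC nAC
  rcases hr with hr | hr
  · exact hc.not_crossing hE (A.1, E.2) B C D ⟨swap_edge swap_upper sB' (by grind) (by grind)
      (by grind), hCD, by grind, nBD, p, q, by grind⟩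
  · exact hc.not_crossing hE (E.1, A.2) B C D ⟨swap_edge swap_lower sB' (by grind) (by grind)
      (by grind), hCD, by grind, nBD, p, q, by grind⟩

lemma crossing_swap (hc : c.Good) (h : c.Crossing A B C D) : c.Crossing A D C B := by
  have hAD := hc.edge_of_crossing h
  have hCB := hc.edge_of_crossing h.symm
  obtain ⟨_, _, nAC, nBD, p, q, hz⟩ := h
  exact ⟨hAD, hCB, nAC, nBD.symm, p, q, by omega⟩

lemma edge_right_of_crossing (hc : c.Good) (h : c.Crossing A B C D) (hE : c.Edge A E) :
    c.Edge C E := by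
  by_cases hED : E = D
  · exact hED ▸ h.snd
  exact hc.edge_of_crossing (hc.crossing_of_edge h hE hED).symm

lemma edge_left_of_crossing (hc : c.Good) (h : c.Crossing A B C D) (hE : c.Edge E B) :
    c.Edge E D := by
  have h' := hc.rot.edge_right_of_crossing h.rot (E := -E) (by simpa [rot_edge] using hE)
  simpa [rot_edge] using h'

/-- The right endpoint of a crossing may be replaced by any neighbour of the left endpoint. -/
lemma crossing_of_edges (hc : c.Good) (h : c.Crossing A B C D) (hE : c.Edge A E)
    (hF : c.Edge A F) (hne : E ≠ F) : c.Crossing A E C F := by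
  by_cases hED : E = D
  · have hF' := hc.edge_right_of_crossing h hF
    subst hED
    have := hc.crossing_of_edge (hc.crossing_swap h.symm) hF' (fun h => hne h.symm)
    exact this.symm
  · have h' := (hc.crossing_of_edge h hE hED).symm
    exact (hc.crossing_of_edge h' (hc.edge_right_of_crossing h hF) (fun h => hne h.symm)).symm

lemma chain_of_edge_aux (hc : c.Good) (h : c.Chain A B C) (hD : c.Edge A D)
    (h₁ : B.1 < D.1) (h₂ : D.2 < B.2) : c.Chain A D C := by
  have hDC : D ≠ C := by
    rintro rfl
    exact hc.not_between hD h.fst.right h.fst.lt₁ h.fst.lt₂ h.snd.lt₁ h.snd.lt₂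
  have hd : ∀ p q, A.1 ≤ p → p < D.1 → A.2 ≤ q → q < D.2 →
      B.1 ≤ p → p < C.1 → B.2 ≤ q → q < C.2 → 2 ≤ c.d p q := by
    intro p q _ _ _ _ _ _ _ _
    by_contra hlt
    exact hc.not_lt_of_crossing ⟨hD, h.snd, by rintro rfl; exact lt_irrefl _ h.fst.lt₁, hDC, p, q,
      by omega⟩ h.fst.lt₁ h.fst.lt₂
  obtain ⟨⟨sA, sB, ab₁, ab₂, fAB⟩, ⟨_, sC, bc₁, bc₂, fBC⟩, ⟨p, q, hz⟩, ⟨p', q', hz'⟩⟩ := h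
  obtain ⟨_, sD, ad₁, ad₂, fAD⟩ := hD
  have hD : c.Edge A D := ⟨sA, sD, ad₁, ad₂, fAD⟩
  have hu := swap_d_le (c := c) (A := A) (B := D)
  have e : ∀ r s, B.1 ≤ r → r < C.1 → D.2 ≤ s → s < B.2 → 1 ≤ c.d r s := by
    intro r s _ _ _ _
    by_contra hlt
    have sB' : (c.swap A D).S B := swap_of_ne sB (by grind) (by grind)
    exact hc.not_chain hD (A.1, D.2) B C ⟨swap_edge swap_upper sB' (by grind) (by grind) (by grind),
      swap_edge sB' (swap_of_ne sC (by grind) (by grind)) (by grind) (by grind) (by grind),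
      ⟨p, q, by grind⟩, ⟨r, s, by grind⟩⟩
  have hq : q' < D.2 := by grind
  have hp : D.1 ≤ p' := by grind
  exact ⟨hD, ⟨sD, sC, by grind, by grind, by grind⟩, ⟨p, q, by grind⟩, ⟨p', q', by grind⟩⟩

lemma chain_of_edge (hc : c.Good) (h : c.Chain A B C) (hD : c.Edge A D) : c.Chain A D C := by
  by_cases hBD : B = D
  · exact hBD ▸ h
  rcases hc.right_of_edges h.fst hD hBD with hr | hr
  · exact hc.chain_of_edge_aux h hD hr.1 hr.2
  · have := hc.tr.chain_of_edge_aux h.tr (D := D.swap) (tr_edge.2 hD) hr.2 hr.1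
    simpa [tr_chain] using this

lemma chain_edge_snd_aux (hc : c.Good) (h : c.Chain A B C) (hQ : c.Edge B Q)
    (h₁ : C.1 < Q.1) (h₂ : Q.2 < C.2) : c.Chain A B Q := by
  obtain ⟨⟨sA, sB, ab₁, ab₂, fAB⟩, ⟨_, sC, bc₁, bc₂, fBC⟩, ⟨p, q, hz⟩, ⟨p', q', hz'⟩⟩ := h
  refine ⟨⟨sA, sB, ab₁, ab₂, fAB⟩, hQ, ?_, ⟨p', q', by grind⟩⟩
  by_contra! hn
  have hu := swap_d_le (c := c) (A := B) (B := Q)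
  have hlt := hQ.lt₁
  have hlt' := hQ.lt₂
  exact hc.not_chain hQ A (B.1, Q.2) C ⟨swap_edge (swap_of_ne sA (by grind) (by grind))
    swap_upper (by grind) (by grind) (by grind), swap_edge swap_upper
    (swap_of_ne sC (by grind) (by grind)) (by grind) (by grind) (by grind),
    ⟨p, q, by grind⟩, ⟨p', q', by grind⟩⟩

lemma chain_edge_snd (hc : c.Good) (h : c.Chain A B C) (hQ : c.Edge B Q) : c.Chain A B Q := by
  by_cases hCQ : C = Q
  · exact hCQ ▸ h
  rcases hc.right_of_edges h.snd hQ hCQ with hr | hr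
  · exact hc.chain_edge_snd_aux h hQ hr.1 hr.2
  · have := hc.tr.chain_edge_snd_aux h.tr (Q := Q.swap) (tr_edge.2 hQ) hr.2 hr.1
    simpa [tr_chain] using this

lemma chain_trans (hc : c.Good) (h : c.Chain A B C) (hQ : c.Edge C Q) : c.Chain B C Q := by
  obtain ⟨⟨sA, sB, ab₁, ab₂, fAB⟩, ⟨_, sC, bc₁, bc₂, fBC⟩, ⟨p, q, hz⟩, ⟨p', q', hz'⟩⟩ := h
  have hu := swap_d_le (c := c) (A := C) (B := Q)
  have hlt := hQ.lt₁
  have hlt' := hQ.lt₂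
  have sB' : (c.swap C Q).S B := swap_of_ne sB (by grind) (by grind)
  have hAB : (c.swap C Q).Edge A B := swap_edge (swap_of_ne sA (by grind) (by grind)) sB' ab₁ ab₂
    (by grind)
  refine ⟨⟨sB, sC, bc₁, bc₂, fBC⟩, hQ, ?_, ?_⟩
  · by_contra! hn
    exact hc.not_chain hQ A B (C.1, Q.2) ⟨hAB, swap_edge sB' swap_upper (by grind) (by grind)
      (by grind), ⟨p, q, by grind⟩, ⟨p', q', by grind⟩⟩
  · by_contra! hn
    exact hc.not_chain hQ A B (Q.1, C.2) ⟨hAB, swap_edge sB' swap_lower (by grind) (by grind)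
      (by grind), ⟨p, q, by grind⟩, ⟨p', q', by grind⟩⟩

lemma chain_of_edge' (hc : c.Good) (h : c.Chain A B C) (hD : c.Edge D C) : c.Chain A D C := by
  have := hc.rot.chain_of_edge h.rot (D := -D) (by simpa [rot_edge] using hD)
  simpa [rot_chain] using this

lemma chain_edge_fst (hc : c.Good) (h : c.Chain A B C) (hP : c.Edge P B) : c.Chain P B C := by
  have := hc.rot.chain_edge_snd h.rot (Q := -P) (by simpa [rot_edge] using hP)
  simpa [rot_chain] using this

lemma chain_of_crossing (hc : c.Good) (h : c.Crossing A B C D) (hQ : c.Edge B Q) :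
    c.Chain A B Q := by
  have hCB := hc.edge_of_crossing h.symm
  have hr := hc.right_of_crossing h
  have hlt := hQ.lt₁
  have hlt' := hQ.lt₂
  have hd : ∀ p q, B.1 ≤ p → p < Q.1 → B.2 ≤ q → q < Q.2 →
      C.1 ≤ p → p < D.1 → C.2 ≤ q → q < D.2 → 2 ≤ c.d p q := by
    intro p q _ _ _ _ _ _ _ _
    by_contra hn
    exact hc.not_lt_of_crossing ⟨h.snd, hQ, by rintro rfl; exact lt_irrefl _ hCB.lt₁,
      by rintro rfl; omega, p, q, by omega⟩ hCB.lt₁ hCB.lt₂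
  obtain ⟨⟨sA, sB, ab₁, ab₂, fAB⟩, ⟨sC, sD, cd₁, cd₂, fCD⟩, nAC, nBD, p, q, hz⟩ := h
  have hu := swap_d_le (c := c) (A := B) (B := Q) p q
  have := hCB.lt₁
  have sA' : (c.swap B Q).S A := swap_of_ne sA (by grind) (by grind)
  have hCD : (c.swap B Q).Edge C D := swap_edge (swap_of_ne sC (by grind) (by grind))
    (swap_of_ne sD (by grind) (by grind)) cd₁ cd₂ (by grind)
  refine ⟨⟨sA, sB, ab₁, ab₂, fAB⟩, hQ, ?_, ?_⟩
  · by_contra! hn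
    exact hc.not_crossing hQ A (B.1, Q.2) C D ⟨swap_edge sA' swap_upper (by grind) (by grind)
      (by grind), hCD, nAC, by grind, p, q, by grind⟩
  · by_contra! hn
    exact hc.not_crossing hQ A (Q.1, B.2) C D ⟨swap_edge sA' swap_lower (by grind) (by grind)
      (by grind), hCD, nAC, by grind, p, q, by grind⟩

lemma edges_of_common_left (hc : c.Good) (h : c.Edge A B) (hD : c.Edge A D) :
    (∀ P, c.Edge P B → c.Edge P D) ∧ ∀ Q, c.Edge B Q → c.Edge D Q := by
  by_cases hBD : B = D
  · subst hBD
    exact ⟨fun _ h => h, fun _ h => h⟩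
  rcases hc.conflict _ _ h with ⟨C, F, hx⟩ | ⟨C, hx⟩ | ⟨C, hx⟩
  · have hx := hc.crossing_of_edges hx h hD hBD
    exact ⟨fun P hP => hc.edge_left_of_crossing hx hP,
      fun Q hQ => (hc.chain_of_edge (hc.chain_of_crossing hx hQ) hD).snd⟩
  · exact ⟨fun P hP => (hc.chain_of_edge' (hc.chain_edge_fst hx hP) (hc.chain_of_edge hx hD).snd).fst,
      fun Q hQ => (hc.chain_of_edge (hc.chain_edge_snd hx hQ) hD).snd⟩
  · exact ⟨fun P hP =>
      (hc.chain_of_edge (hc.chain_edge_snd hx hD) (hc.chain_of_edge' hx hP).fst).snd,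
      fun Q hQ => (hc.chain_of_edge (hc.chain_trans hx hQ) hD).snd⟩

lemma crossing_of_disjoint (hc : c.Good) (h : c.Crossing A B C D) (hPQ : c.Edge P Q)
    (hP : P ≠ A ∧ P ≠ B ∧ P ≠ C ∧ P ≠ D) (hQ : Q ≠ A ∧ Q ≠ B ∧ Q ≠ C ∧ Q ≠ D) :
    c.Crossing P Q A B ∨ c.Crossing P Q C D := by
  by_contra! hn
  obtain ⟨⟨sA, sB, ab₁, ab₂, fAB⟩, ⟨sC, sD, cd₁, cd₂, fCD⟩, nAC, nBD, p, q, hz⟩ := h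
  have hu := swap_d_le (c := c) (A := P) (B := Q) p q
  have e₁ : ∀ p q, P.1 ≤ p → p < Q.1 → P.2 ≤ q → q < Q.2 →
      A.1 ≤ p → p < B.1 → A.2 ≤ q → q < B.2 → 2 ≤ c.d p q := by
    intro p q _ _ _ _ _ _ _ _
    by_contra hlt
    exact hn.1 ⟨hPQ, ⟨sA, sB, ab₁, ab₂, fAB⟩, hP.1, hQ.2.1, p, q, by omega⟩
  have e₂ : ∀ p q, P.1 ≤ p → p < Q.1 → P.2 ≤ q → q < Q.2 →
      C.1 ≤ p → p < D.1 → C.2 ≤ q → q < D.2 → 2 ≤ c.d p q := by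
    intro p q _ _ _ _ _ _ _ _
    by_contra hlt
    exact hn.2 ⟨hPQ, ⟨sC, sD, cd₁, cd₂, fCD⟩, hP.2.2.1, hQ.2.2.2, p, q, by omega⟩
  exact hc.not_crossing hPQ A B C D ⟨swap_edge (swap_of_ne sA (by grind) (by grind))
    (swap_of_ne sB (by grind) (by grind)) ab₁ ab₂ (by grind),
    swap_edge (swap_of_ne sC (by grind) (by grind))
    (swap_of_ne sD (by grind) (by grind)) cd₁ cd₂ (by grind), nAC, nBD, p, q, by omega⟩

lemma crossing_of_disjoint_chain (hc : c.Good) (h : c.Chain A B C) (hPQ : c.Edge P Q)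
    (hP : P ≠ A ∧ P ≠ B ∧ P ≠ C) (hQ : Q ≠ A ∧ Q ≠ B ∧ Q ≠ C) :
    c.Crossing P Q A B ∨ c.Crossing P Q B C := by
  by_contra! hn
  obtain ⟨⟨sA, sB, ab₁, ab₂, fAB⟩, ⟨_, sC, bc₁, bc₂, fBC⟩, ⟨p, q, hz⟩, ⟨p', q', hz'⟩⟩ := h
  have hu := swap_d_le (c := c) (A := P) (B := Q)
  have e₁ : ∀ p q, P.1 ≤ p → p < Q.1 → P.2 ≤ q → q < Q.2 →
      A.1 ≤ p → p < B.1 → A.2 ≤ q → q < B.2 → 2 ≤ c.d p q := by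
    intro p q _ _ _ _ _ _ _ _
    by_contra hlt
    exact hn.1 ⟨hPQ, ⟨sA, sB, ab₁, ab₂, fAB⟩, hP.1, hQ.2.1, p, q, by omega⟩
  have e₂ : ∀ p q, P.1 ≤ p → p < Q.1 → P.2 ≤ q → q < Q.2 →
      B.1 ≤ p → p < C.1 → B.2 ≤ q → q < C.2 → 2 ≤ c.d p q := by
    intro p q _ _ _ _ _ _ _ _
    by_contra hlt
    exact hn.2 ⟨hPQ, ⟨sB, sC, bc₁, bc₂, fBC⟩, hP.2.1, hQ.2.2, p, q, by omega⟩
  have sB' : (c.swap P Q).S B := swap_of_ne sB (by grind) (by grind)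
  exact hc.not_chain hPQ A B C ⟨swap_edge (swap_of_ne sA (by grind) (by grind))
    sB' ab₁ ab₂ (by grind),
    swap_edge sB' (swap_of_ne sC (by grind) (by grind)) bc₁ bc₂ (by grind),
    ⟨p, q, by grind⟩, ⟨p', q', by grind⟩⟩

end Good

/-- Adjacency of points: being the endpoints of a common edge. -/
def Adj (c : Config) (X Y : ℤ × ℤ) : Prop := c.Edge X Y ∨ c.Edge Y X

/-- Being connected by a path of edges. -/
def Conn (c : Config) : ℤ × ℤ → ℤ × ℤ → Prop := Relation.ReflTransGen c.Adj

lemma Conn.symm (h : c.Conn X Y) : c.Conn Y X := by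
  induction h with
  | refl => exact .refl
  | tail _ h ih => exact .head (Or.symm h) ih

lemma Conn.trans (h : c.Conn X Y) (h' : c.Conn Y Z) : c.Conn X Z :=
  Relation.ReflTransGen.trans h h'

lemma Edge.conn (h : c.Edge X Y) : c.Conn X Y := Relation.ReflTransGen.single (Or.inl h)

/-- Two points with the same neighbours. -/
def Twin (c : Config) (X Y : ℤ × ℤ) : Prop :=
  ∀ Z, (c.Edge X Z ↔ c.Edge Y Z) ∧ (c.Edge Z X ↔ c.Edge Z Y)

lemma Twin.symm (h : c.Twin X Y) : c.Twin Y X := fun Z => ⟨(h Z).1.symm, (h Z).2.symm⟩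

lemma Twin.trans (h : c.Twin X Y) (h' : c.Twin Y Z) : c.Twin X Z :=
  fun W => ⟨(h W).1.trans (h' W).1, (h W).2.trans (h' W).2⟩

lemma lt_of_transGen (h : Relation.TransGen c.Edge X Y) : X.1 < Y.1 ∧ X.2 < Y.2 := by
  induction h with
  | single h => exact ⟨h.lt₁, h.lt₂⟩
  | tail _ h ih => exact ⟨ih.1.trans h.lt₁, ih.2.trans h.lt₂⟩

namespace Good

lemma conn_of_crossing (hc : c.Good) (h : c.Crossing A B C D) :
    c.Conn A B ∧ c.Conn A C ∧ c.Conn A D :=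
  ⟨h.fst.conn, h.fst.conn.trans (hc.edge_of_crossing h.symm).conn.symm,
    (hc.edge_of_crossing h).conn⟩

lemma conn_of_edges (hc : c.Good) (h : c.Edge A B) (hPQ : c.Edge P Q) : c.Conn A P := by
  have hPQ' := hPQ.conn
  have key : c.Conn A P ∨ c.Conn A Q := by
    rcases hc.conflict _ _ h with ⟨C, D, hx⟩ | ⟨C, hx⟩ | ⟨C, hx⟩
    · obtain ⟨k₁, k₂, k₃⟩ := hc.conn_of_crossing hx
      by_cases hP : P ≠ A ∧ P ≠ B ∧ P ≠ C ∧ P ≠ D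
      · by_cases hQ : Q ≠ A ∧ Q ≠ B ∧ Q ≠ C ∧ Q ≠ D
        · rcases hc.crossing_of_disjoint hx hPQ hP hQ with hy | hy
          · exact Or.inl (hc.conn_of_crossing hy).2.1.symm
          · exact Or.inl (k₂.trans (hc.conn_of_crossing hy).2.1.symm)
        · have : c.Conn A A := Relation.ReflTransGen.refl
          grind
      · have : c.Conn A A := Relation.ReflTransGen.refl
        grind
    all_goals
      have k₁ := hx.fst.conn
      have k₂ := hx.snd.conn
      have k₃ := k₁.symm
      have k₄ := k₁.trans k₂
    · by_cases hP : P ≠ A ∧ P ≠ B ∧ P ≠ C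
      · by_cases hQ : Q ≠ A ∧ Q ≠ B ∧ Q ≠ C
        · rcases hc.crossing_of_disjoint_chain hx hPQ hP hQ with hy | hy
          · exact Or.inl (hc.conn_of_crossing hy).2.1.symm
          · exact Or.inl (k₁.trans (hc.conn_of_crossing hy).2.1.symm)
        · have : c.Conn A A := Relation.ReflTransGen.refl
          grind
      · have : c.Conn A A := Relation.ReflTransGen.refl
        grind
    · by_cases hP : P ≠ C ∧ P ≠ A ∧ P ≠ B
      · by_cases hQ : Q ≠ C ∧ Q ≠ A ∧ Q ≠ B
        · rcases hc.crossing_of_disjoint_chain hx hPQ hP hQ with hy | hy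
          · exact Or.inl (k₁.symm.trans (hc.conn_of_crossing hy).2.1.symm)
          · exact Or.inl (hc.conn_of_crossing hy).2.1.symm
        · have : c.Conn A A := Relation.ReflTransGen.refl
          grind
      · have : c.Conn A A := Relation.ReflTransGen.refl
        grind
  exact key.elim id fun h => h.trans hPQ'.symm

lemma conn_of_adj (hc : c.Good) (h : c.Adj A B) (h' : c.Adj P Q) : c.Conn A P := by
  rcases h with h | h <;> rcases h' with h' | h'
  · exact hc.conn_of_edges h h'
  · exact (hc.conn_of_edges h h').trans h'.conn
  · exact h.conn.symm.trans (hc.conn_of_edges h h')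
  · exact (h.conn.symm.trans (hc.conn_of_edges h h')).trans h'.conn

lemma twin_of_common_left (hc : c.Good) (h : c.Edge A B) (h' : c.Edge A D) : c.Twin B D := by
  have h₁ := hc.edges_of_common_left h h'
  have h₂ := hc.edges_of_common_left h' h
  exact fun Z => ⟨⟨h₁.2 Z, h₂.2 Z⟩, ⟨h₁.1 Z, h₂.1 Z⟩⟩

lemma twin_of_common_right (hc : c.Good) (h : c.Edge B A) (h' : c.Edge D A) : c.Twin B D := by
  have := hc.rot.twin_of_common_left (A := -A) (B := -B) (D := -D) (by simpa [rot_edge] using h)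
    (by simpa [rot_edge] using h')
  intro Z
  have := this (-Z)
  simp only [rot_edge, neg_neg] at this
  exact this.symm

lemma twin_or_transGen (hc : c.Good) (h : c.Conn X Y) :
    c.Twin X Y ∨ Relation.TransGen c.Edge X Y ∨ Relation.TransGen c.Edge Y X := by
  induction h with
  | refl => exact Or.inl fun Z => ⟨Iff.rfl, Iff.rfl⟩
  | @tail Y Z _ hYZ ih =>
    rcases ih with ih | ih | ih <;> rcases hYZ with h | h
    · exact Or.inr (Or.inl (.single ((ih Z).1.2 h)))
    · exact Or.inr (Or.inr (.single ((ih Z).2.2 h)))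
    · exact Or.inr (Or.inl (ih.tail h))
    · obtain ⟨W, hW, hWY⟩ := Relation.TransGen.tail'_iff.1 ih
      have t := hc.twin_of_common_right hWY h
      rcases Relation.ReflTransGen.cases_tail hW with rfl | ⟨V, hV, hVW⟩
      · exact Or.inl t
      · exact Or.inr (Or.inl (Relation.TransGen.tail' hV ((t V).2.1 hVW)))
    · obtain ⟨W, hYW, hW⟩ := Relation.TransGen.head'_iff.1 ih
      have t := hc.twin_of_common_left hYW h
      rcases Relation.ReflTransGen.cases_head hW with rfl | ⟨V, hWV, hV⟩
      · exact Or.inl t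
      · exact Or.inr (Or.inr (Relation.TransGen.head' ((t V).1.1 hWV) hV))
    · exact Or.inr (Or.inr (ih.head h))

lemma twin_of_not_lt (hc : c.Good) (hX : c.Adj X A) (hY : c.Adj Y B)
    (h : ¬ (X.1 < Y.1 ∧ X.2 < Y.2)) (h' : ¬ (Y.1 < X.1 ∧ Y.2 < X.2)) : c.Twin X Y := by
  rcases hc.twin_or_transGen (hc.conn_of_adj hX hY) with t | t | t
  · exact t
  · exact absurd (lt_of_transGen t) h
  · exact absurd (lt_of_transGen t) h'

/-- Incomparability is transitive on the endpoints of edges. -/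
lemma not_lt_trans (hc : c.Good) (hX : c.Adj X A) (hY : c.Adj Y B) (hZ : c.Adj Z C)
    (h₁ : ¬ (X.1 < Y.1 ∧ X.2 < Y.2)) (h₁' : ¬ (Y.1 < X.1 ∧ Y.2 < X.2))
    (h₂ : ¬ (Y.1 < Z.1 ∧ Y.2 < Z.2)) (h₂' : ¬ (Z.1 < Y.1 ∧ Z.2 < Y.2)) :
    ¬ (X.1 < Z.1 ∧ X.2 < Z.2) := by
  have t := (hc.twin_of_not_lt hX hY h₁ h₁').trans (hc.twin_of_not_lt hY hZ h₂ h₂')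
  rintro ⟨h, h'⟩
  rcases hX with e | e
  · have e' := (t A).1.1 e
    exact hc.not_between e e'.left h h' e'.lt₁ e'.lt₂
  · have e' := (t A).2.1 e
    exact hc.not_between e' e.right e.lt₁ e.lt₂ h h'

end Good

/-- The contribution of a pair of points to the sum of the number of inversions and the number
of edges. -/
noncomputable def weight (c : Config) (X Y : ℤ × ℤ) : ℤ :=
  (if X.1 < Y.1 ∧ Y.2 < X.2 then 1 else 0) + if c.Edge X Y then 1 else 0

/-- All labels in a block of cells are positive. -/
def Free (c : Config) (p p' q q' : ℤ) : Prop :=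
  ∀ r s, p ≤ r → r < p' → q ≤ s → s < q' → 1 ≤ c.d r s

lemma edge_iff (hX : c.S X) (hY : c.S Y) :
    c.Edge X Y ↔ X.1 < Y.1 ∧ X.2 < Y.2 ∧ c.Free X.1 Y.1 X.2 Y.2 :=
  ⟨fun h => ⟨h.lt₁, h.lt₂, h.free⟩, fun h => ⟨hX, hY, h.1, h.2.1, h.2.2⟩⟩

lemma swap_free (p p' q q' : ℤ) (h : p' ≤ A.1 ∨ B.1 ≤ p ∨ q' ≤ A.2 ∨ B.2 ≤ q) :
    (c.swap A B).Free p p' q q' ↔ c.Free p p' q q' := by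
  refine forall₂_congr fun r s => ?_
  simp only [swap]
  grind

lemma free_split₁ (p m p' q q' : ℤ) (h : p ≤ m) (h' : m ≤ p') :
    c.Free p p' q q' ↔ c.Free p m q q' ∧ c.Free m p' q q' := by
  simp only [Free]
  grind

lemma free_split₂ (p p' q m q' : ℤ) (h : q ≤ m) (h' : m ≤ q') :
    c.Free p p' q q' ↔ c.Free p p' q m ∧ c.Free p p' m q' := by
  simp only [Free]
  grind

lemma Free.mono {p p' q q' r r' s s' : ℤ} (h : c.Free p p' q q') (h₁ : p ≤ r) (h₂ : r' ≤ p')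
    (h₃ : q ≤ s) (h₄ : s' ≤ q') : c.Free r r' s s' := by
  simp only [Free] at h ⊢
  grind

lemma chain_iff : c.Chain A B C ↔ c.Edge A B ∧ c.Edge B C ∧ ¬ c.Free A.1 B.1 B.2 C.2 ∧
    ¬ c.Free B.1 C.1 A.2 B.2 := by
  have e : ∀ p p' q q', ¬ c.Free p p' q q' ↔
      ∃ r s, p ≤ r ∧ r < p' ∧ q ≤ s ∧ s < q' ∧ c.d r s ≤ 0 := by
    intro p p' q q'
    simp only [Free]
    push Not
    simp only [Int.lt_iff_add_one_le]
    refine exists₂_congr fun r s => ?_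
    omega
  rw [e, e]
  exact ⟨fun h => ⟨h.1, h.2, h.3, h.4⟩, fun h => ⟨h.1, h.2.1, h.2.2.1, h.2.2.2⟩⟩

lemma weight_swap (h : c.Edge A B) (hX : c.S X) (a₁ : X.1 ≠ A.1) (a₂ : X.2 ≠ A.2)
    (b₁ : X.1 ≠ B.1) (b₂ : X.2 ≠ B.2) :
    c.weight A X + c.weight X A + c.weight B X + c.weight X B =
      (c.swap A B).weight (A.1, B.2) X + (c.swap A B).weight X (A.1, B.2) +
      (c.swap A B).weight (B.1, A.2) X + (c.swap A B).weight X (B.1, A.2) +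
      if c.Chain A B X ∨ c.Chain X A B then 1 else 0 := by
  have hX' : (c.swap A B).S X := swap_of_ne hX (by grind) (by grind)
  have hab₁ := h.lt₁
  have hab₂ := h.lt₂
  have hf : c.Free A.1 B.1 A.2 B.2 := h.free
  simp only [weight, chain_iff, edge_iff h.left hX, edge_iff hX h.left, edge_iff h.right hX,
    edge_iff hX h.right, edge_iff swap_upper hX', edge_iff hX' swap_upper,
    edge_iff swap_lower hX', edge_iff hX' swap_lower, edge_iff h.left h.right]
  have fs := @swap_free c A B
  rcases lt_or_gt_of_ne a₁ with u | u
  · rcases lt_or_gt_of_ne a₂ with v | v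
    · have s₁ := c.free_split₁ X.1 A.1 B.1 X.2 B.2 (by omega) (by omega)
      have s₂ := c.free_split₂ X.1 A.1 X.2 A.2 B.2 (by omega) (by omega)
      have s₃ := c.free_split₂ A.1 B.1 X.2 A.2 B.2 (by omega) (by omega)
      have s₄ := c.free_split₁ X.1 A.1 B.1 X.2 A.2 (by omega) (by omega)
      have t₁ := fs X.1 A.1 X.2 B.2 (by omega)
      have t₂ := fs X.1 B.1 X.2 A.2 (by omega)
      simp only [lt_asymm u, lt_asymm v, u, v, hab₁, hab₂, u.trans hab₁, v.trans hab₂]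
      simp
      grind
    · rcases lt_or_gt_of_ne b₂ with v' | v'
      · have s₁ := c.free_split₁ X.1 A.1 B.1 X.2 B.2 (by omega) (by omega)
        have t₁ := fs X.1 A.1 X.2 B.2 (by omega)
        have m := fun h : c.Free X.1 A.1 X.2 B.2 => s₁.2 ⟨h, hf.mono le_rfl le_rfl v.le le_rfl⟩
        simp [lt_asymm u, lt_asymm v, lt_asymm v', u, v, v', u.trans hab₁, lt_asymm (u.trans hab₁)]
        grind
      · simp [lt_asymm u, lt_asymm v, lt_asymm v', u, v, v', u.trans hab₁, lt_asymm (u.trans hab₁)]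
  · rcases lt_or_gt_of_ne b₁ with u' | u'
    · rcases lt_or_gt_of_ne a₂ with v | v
      · have s₁ := c.free_split₂ X.1 B.1 X.2 A.2 B.2 (by omega) (by omega)
        have t₁ := fs X.1 B.1 X.2 A.2 (by omega)
        have m := fun h : c.Free X.1 B.1 X.2 A.2 => s₁.2 ⟨h, hf.mono u.le le_rfl le_rfl le_rfl⟩
        simp [lt_asymm u, lt_asymm v, lt_asymm u', u, v, u', v.trans hab₂, lt_asymm (v.trans hab₂)]
        grind
      · rcases lt_or_gt_of_ne b₂ with v' | v'
        · have m₁ := hf.mono le_rfl u'.le le_rfl v'.le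
          have m₂ := hf.mono u.le le_rfl v.le le_rfl
          simp [lt_asymm u, lt_asymm v, lt_asymm u', lt_asymm v', u, v, u', v', m₁, m₂]
        · have s₁ := c.free_split₂ A.1 X.1 A.2 B.2 X.2 (by omega) (by omega)
          have t₁ := fs A.1 X.1 B.2 X.2 (by omega)
          have m := fun h : c.Free A.1 X.1 B.2 X.2 => s₁.2 ⟨hf.mono le_rfl u'.le le_rfl le_rfl, h⟩
          simp [lt_asymm u, lt_asymm v, lt_asymm u', lt_asymm v', u, v, u', v']
          grind
    · rcases lt_or_gt_of_ne b₂ with v' | v'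
      · rcases lt_or_gt_of_ne a₂ with v | v
        · simp [lt_asymm u, lt_asymm v, lt_asymm u', lt_asymm v', u, v, u', v']
        · have s₁ := c.free_split₁ A.1 B.1 X.1 A.2 X.2 (by omega) (by omega)
          have t₁ := fs B.1 X.1 A.2 X.2 (by omega)
          have m := fun h : c.Free B.1 X.1 A.2 X.2 => s₁.2 ⟨hf.mono le_rfl le_rfl le_rfl v'.le, h⟩
          simp [lt_asymm u, lt_asymm v, lt_asymm u', lt_asymm v', u, v, u', v']
          grind
      · have s₁ := c.free_split₁ A.1 B.1 X.1 A.2 X.2 (by omega) (by omega)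
        have s₂ := c.free_split₂ B.1 X.1 A.2 B.2 X.2 (by omega) (by omega)
        have s₃ := c.free_split₂ A.1 B.1 A.2 B.2 X.2 (by omega) (by omega)
        have s₄ := c.free_split₁ A.1 B.1 X.1 B.2 X.2 (by omega) (by omega)
        have t₁ := fs A.1 X.1 B.2 X.2 (by omega)
        have t₂ := fs B.1 X.1 A.2 X.2 (by omega)
        simp only [lt_asymm u', lt_asymm v', u', v', hab₁, hab₂, hab₁.trans u', hab₂.trans v',
          lt_asymm u, lt_asymm (hab₂.trans v')]
        simp
        grind

lemma weight_swap_of_ne (h : c.S X) (hY : c.S Y) (hXA : X ≠ A) (hXB : X ≠ B) (hYA : Y ≠ A)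
    (hYB : Y ≠ B) (hAB : c.Edge A B) :
    c.weight X Y = (c.swap A B).weight X Y + if c.Crossing A B X Y then 1 else 0 := by
  have e : (c.swap A B).Edge X Y ↔ c.Edge X Y ∧ ¬ c.Crossing A B X Y := by
    constructor
    · rintro ⟨_, _, h₁, h₂, hf⟩
      refine ⟨⟨h, hY, h₁, h₂, fun p q a b e f => (hf p q a b e f).trans (swap_d_le p q)⟩, ?_⟩
      rintro ⟨_, _, _, _, p, q, hz⟩
      have := hf p q (by omega) (by omega) (by omega) (by omega)
      simp only [swap] at this
      rw [if_pos (by omega)] at this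
      omega
    · rintro ⟨hE, hx⟩
      refine swap_edge (swap_of_ne h hXA hXB) (swap_of_ne hY hYA hYB) hE.lt₁ hE.lt₂
        fun p q a b e f => ⟨hE.free p q a b e f, fun _ _ _ _ => ?_⟩
      by_contra hlt
      exact hx ⟨hAB, hE, hXA.symm, hYB.symm, p, q, by omega⟩
  have hs : c.Crossing A B X Y → c.Edge X Y := fun h => h.snd
  simp only [weight, e]
  grind

end Config

section Permutations

variable {n : ℕ} {x w : Equiv.Perm (Fin n)} {a b : Fin n}

/-- The point of the graph of a permutation at a given position. -/
def pt (x : Equiv.Perm (Fin n)) (i : Fin n) : ℤ × ℤ := (((i : ℕ) : ℤ), ((x i : ℕ) : ℤ))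

/-- The graph of `x`, with the difference function `d_{x,w}` as labelling. -/
def cfg (x w : Equiv.Perm (Fin n)) : Config where
  S X := ∃ i, X = pt x i
  d p q := dxw x w (p + 1) (q + 2)

lemma cfg_pt (i : Fin n) : (cfg x w).S (pt x i) := ⟨i, rfl⟩

lemma pt_injective : Function.Injective (pt x) := by
  intro i j h
  simp only [pt, Prod.mk.injEq] at h
  exact Fin.ext (by exact_mod_cast h.1)

lemma pt_fst_lt {i j : Fin n} : (pt x i).1 < (pt x j).1 ↔ i < j := by
  simp [pt]

lemma pt_snd_lt {i j : Fin n} : (pt x i).2 < (pt x j).2 ↔ x i < x j := by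
  simp [pt]

lemma pt_fst_ne {i j : Fin n} (h : i ≠ j) : (pt x i).1 ≠ (pt x j).1 := by
  simpa [pt, Fin.val_inj] using h

lemma pt_snd_ne {i j : Fin n} (h : i ≠ j) : (pt x i).2 ≠ (pt x j).2 := by
  simpa [pt, Fin.val_inj] using h

lemma rank_eq_sum (w : Equiv.Perm (Fin n)) (p q : ℤ) : (rank w (p + 1) (q + 2) : ℤ) =
    ∑ i, if (pt w i).1 ≤ p ∧ q < (pt w i).2 then 1 else 0 := by
  rw [rank, Finset.natCast_card_filter]
  refine Finset.sum_congr rfl fun i _ => if_congr ?_ rfl rfl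
  simp only [pt]
  omega

lemma cfg_d (p q : ℤ) : (cfg x w).d p q =
    ∑ i, ((if (pt w i).1 ≤ p ∧ q < (pt w i).2 then 1 else 0) -
      if (pt x i).1 ≤ p ∧ q < (pt x i).2 then 1 else 0) := by
  rw [Finset.sum_sub_distrib, ← rank_eq_sum, ← rank_eq_sum]
  rfl

lemma bruhatLE_iff : bruhatLE x w ↔ ∀ p q, 0 ≤ (cfg x w).d p q := by
  refine ⟨fun h p q => h _ _, fun h p q => ?_⟩
  have := h (p - 1) (q - 2)
  simpa [cfg] using this

lemma pt_swap_left : pt (x * Equiv.swap a b) a = ((pt x a).1, (pt x b).2) := by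
  simp [pt]

lemma pt_swap_right : pt (x * Equiv.swap a b) b = ((pt x b).1, (pt x a).2) := by
  simp [pt]

lemma pt_swap_of_ne {i : Fin n} (h₁ : i ≠ a) (h₂ : i ≠ b) :
    pt (x * Equiv.swap a b) i = pt x i := by
  simp [pt, Equiv.swap_apply_of_ne_of_ne h₁ h₂]

/-- All positions except the two given ones. -/
def others (a b : Fin n) : Finset (Fin n) := Finset.univ.filter fun i => i ≠ a ∧ i ≠ b

lemma mem_others {i : Fin n} : i ∈ others a b ↔ i ≠ a ∧ i ≠ b := by
  simp [others]

lemma sum_split {a b : Fin n} (h : a ≠ b) (f : Fin n → ℤ) :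
    ∑ i, f i = f a + f b + ∑ i ∈ others a b, f i := by
  have : others a b = (Finset.univ.erase a).erase b := by
    ext i
    simp [others, and_comm]
  rw [this, add_assoc, Finset.add_sum_erase _ _ (by simpa using h.symm),
    Finset.add_sum_erase _ _ (Finset.mem_univ a)]

lemma cfg_swap (h₁ : a < b) (h₂ : x a < x b) :
    cfg (x * Equiv.swap a b) w = (cfg x w).swap (pt x a) (pt x b) := by
  ext X q
  · simp only [Config.swap, cfg]
    constructor
    · rintro ⟨i, rfl⟩
      by_cases ha : i = a
      · subst ha; exact Or.inr (Or.inl pt_swap_left)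
      by_cases hb : i = b
      · subst hb; exact Or.inr (Or.inr pt_swap_right)
      rw [pt_swap_of_ne ha hb]
      exact Or.inl ⟨⟨i, rfl⟩, pt_injective.ne ha, pt_injective.ne hb⟩
    · rintro (⟨⟨i, rfl⟩, ha, hb⟩ | rfl | rfl)
      · exact ⟨i, (pt_swap_of_ne (by rintro rfl; exact ha rfl) (by rintro rfl; exact hb rfl)).symm⟩
      · exact ⟨a, pt_swap_left.symm⟩
      · exact ⟨b, pt_swap_right.symm⟩
  · simp only [Config.swap]
    have hab : a ≠ b := h₁.ne
    rw [cfg_d, cfg_d, sum_split hab, sum_split hab, pt_swap_left, pt_swap_right]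
    have e : ∀ i ∈ others a b, pt (x * Equiv.swap a b) i = pt x i := fun i hi =>
      pt_swap_of_ne (mem_others.1 hi).1 (mem_others.1 hi).2
    rw [Finset.sum_congr rfl fun i hi => by rw [e i hi]]
    have u₁ : (pt x a).1 < (pt x b).1 := pt_fst_lt.2 h₁
    have u₂ : (pt x a).2 < (pt x b).2 := pt_snd_lt.2 h₂
    grind

lemma sum_sum_split {a b : Fin n} (h : a ≠ b) (f : Fin n → Fin n → ℤ) :
    ∑ i, ∑ j, f i j = f a a + f a b + f b a + f b b +
      ∑ i ∈ others a b, (f a i + f i a + f b i + f i b) +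
      ∑ i ∈ others a b, ∑ j ∈ others a b, f i j := by
  simp only [sum_split h, Finset.sum_add_distrib]
  ring

/-- The sum of the length of `x` and the number of edges. -/
noncomputable def total (x w : Equiv.Perm (Fin n)) : ℤ :=
  ∑ i, ∑ j, (cfg x w).weight (pt x i) (pt x j)

lemma total_eq : total x w = invLen x +
    (Finset.univ.filter fun p : Fin n × Fin n => (cfg x w).Edge (pt x p.1) (pt x p.2)).card := by
  rw [total, invLen, Finset.natCast_card_filter, Finset.natCast_card_filter,
    ← Finset.sum_add_distrib, ← Finset.univ_product_univ, Finset.sum_product]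
  simp only [Config.weight, pt_fst_lt, pt_snd_lt]

lemma total_swap (h : (cfg x w).Edge (pt x a) (pt x b)) :
    total x w = total (x * Equiv.swap a b) w +
      (∑ i ∈ others a b, if (cfg x w).Chain (pt x a) (pt x b) (pt x i) ∨
        (cfg x w).Chain (pt x i) (pt x a) (pt x b) then 1 else 0) +
      ∑ i ∈ others a b, ∑ j ∈ others a b,
        if (cfg x w).Crossing (pt x a) (pt x b) (pt x i) (pt x j) then 1 else 0 := by
  have h₁ := pt_fst_lt.1 h.lt₁
  have h₂ := pt_snd_lt.1 h.lt₂
  have hab : a ≠ b := h₁.ne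
  have e : ∀ i ∈ others a b, pt (x * Equiv.swap a b) i = pt x i := fun i hi =>
    pt_swap_of_ne (mem_others.1 hi).1 (mem_others.1 hi).2
  have f₁ : ∀ i ∈ others a b, pt x i ≠ pt x a := fun i hi => pt_injective.ne (mem_others.1 hi).1
  have f₂ : ∀ i ∈ others a b, pt x i ≠ pt x b := fun i hi => pt_injective.ne (mem_others.1 hi).2
  have k₁ := Finset.sum_congr rfl fun i hi => Config.weight_swap h (cfg_pt i)
    (pt_fst_ne (mem_others.1 hi).1) (pt_snd_ne (mem_others.1 hi).1)
    (pt_fst_ne (mem_others.1 hi).2) (pt_snd_ne (mem_others.1 hi).2)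
  have k₂ := Finset.sum_congr rfl fun i hi => Finset.sum_congr rfl fun j hj =>
    Config.weight_swap_of_ne (cfg_pt i) (cfg_pt j) (f₁ i hi) (f₂ i hi) (f₁ j hj) (f₂ j hj) h
  have k₃ : ∑ i ∈ others a b, ((cfg (x * Equiv.swap a b) w).weight (pt (x * Equiv.swap a b) a)
      (pt (x * Equiv.swap a b) i) + (cfg (x * Equiv.swap a b) w).weight
      (pt (x * Equiv.swap a b) i) (pt (x * Equiv.swap a b) a) +
      (cfg (x * Equiv.swap a b) w).weight (pt (x * Equiv.swap a b) b)
      (pt (x * Equiv.swap a b) i) + (cfg (x * Equiv.swap a b) w).weight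
      (pt (x * Equiv.swap a b) i) (pt (x * Equiv.swap a b) b)) = _ :=
    Finset.sum_congr rfl fun i hi => by
      rw [e i hi, pt_swap_left, pt_swap_right, cfg_swap h₁ h₂]
  have k₄ : ∑ i ∈ others a b, ∑ j ∈ others a b, (cfg (x * Equiv.swap a b) w).weight
      (pt (x * Equiv.swap a b) i) (pt (x * Equiv.swap a b) j) = _ :=
    Finset.sum_congr rfl fun i hi => Finset.sum_congr rfl fun j hj => by
      rw [e i hi, e j hj, cfg_swap h₁ h₂]
  have d : ∀ (c : Config) X, c.weight X X = 0 := by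
    intro c X
    have : ¬ c.Edge X X := fun h => lt_irrefl _ h.lt₁
    simp [Config.weight, this]
  have g₁ : (cfg (x * Equiv.swap a b) w).weight (pt (x * Equiv.swap a b) a)
      (pt (x * Equiv.swap a b) b) = 1 := by
    rw [pt_swap_left, pt_swap_right]
    have : ¬ (cfg (x * Equiv.swap a b) w).Edge ((pt x a).1, (pt x b).2)
      ((pt x b).1, (pt x a).2) := fun h' => lt_asymm h.lt₂ h'.lt₂
    simp [Config.weight, this, h.lt₁, h.lt₂]
  have g₂ : (cfg (x * Equiv.swap a b) w).weight (pt (x * Equiv.swap a b) b)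
      (pt (x * Equiv.swap a b) a) = 0 := by
    rw [pt_swap_left, pt_swap_right]
    have : ¬ (cfg (x * Equiv.swap a b) w).Edge ((pt x b).1, (pt x a).2)
      ((pt x a).1, (pt x b).2) := fun h' => lt_asymm h.lt₁ h'.lt₁
    simp [Config.weight, this, h.lt₁.le]
  have g₃ : (cfg x w).weight (pt x a) (pt x b) = 1 := by
    simp [Config.weight, h, h.lt₂.le]
  have g₄ : (cfg x w).weight (pt x b) (pt x a) = 0 := by
    have : ¬ (cfg x w).Edge (pt x b) (pt x a) := fun h' => lt_asymm h.lt₁ h'.lt₁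
    simp [Config.weight, this, h.lt₁.le]
  rw [total, total, sum_sum_split hab, sum_sum_split hab fun i j =>
    (cfg (x * Equiv.swap a b) w).weight _ _, k₁, k₂, k₃, k₄, g₁, g₂, g₃, g₄]
  simp only [d, Finset.sum_add_distrib]
  ring

/-- An edge is in conflict if its endpoints may not be exchanged without losing an edge. -/
def Conflict (c : Config) (A B : ℤ × ℤ) : Prop :=
  (∃ C D, c.Crossing A B C D) ∨ (∃ C, c.Chain A B C) ∨ ∃ C, c.Chain C A B

lemma total_swap_le (h : (cfg x w).Edge (pt x a) (pt x b)) :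
    total (x * Equiv.swap a b) w ≤ total x w := by
  rw [total_swap h, add_assoc]
  refine le_add_of_nonneg_right (add_nonneg (Finset.sum_nonneg fun i _ => ?_)
    (Finset.sum_nonneg fun i _ => Finset.sum_nonneg fun j _ => ?_))
  all_goals split_ifs <;> simp

lemma total_swap_lt_iff (h : (cfg x w).Edge (pt x a) (pt x b)) :
    total (x * Equiv.swap a b) w < total x w ↔ Conflict (cfg x w) (pt x a) (pt x b) := by
  have i₁ : ∀ (p : Prop) [Decidable p], (0 : ℤ) ≤ if p then 1 else 0 := fun p _ => by
    split_ifs <;> simp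
  have i₂ : ∀ i ∈ others a b, (0 : ℤ) ≤ ∑ j ∈ others a b,
      if (cfg x w).Crossing (pt x a) (pt x b) (pt x i) (pt x j) then 1 else 0 :=
    fun i _ => Finset.sum_nonneg fun j _ => i₁ _
  have s₁ := Finset.sum_nonneg fun i (_ : i ∈ others a b) => i₁ ((cfg x w).Chain (pt x a) (pt x b)
    (pt x i) ∨ (cfg x w).Chain (pt x i) (pt x a) (pt x b))
  have s₂ := Finset.sum_nonneg i₂
  constructor
  · intro hlt
    by_contra hn
    simp only [Conflict, not_or, not_exists] at hn
    rw [total_swap h] at hlt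
    simp [hn] at hlt
  · intro hx
    rw [total_swap h]
    rcases hx with ⟨C, D, hx⟩ | ⟨C, hx⟩ | ⟨C, hx⟩
    · obtain ⟨i, rfl⟩ := hx.snd.left
      obtain ⟨j, rfl⟩ := hx.snd.right
      have hi : i ∈ others a b := mem_others.2 ⟨by rintro rfl; exact hx.ne_left rfl, by
        rintro rfl; obtain ⟨p, q, hz⟩ := hx.cell; omega⟩
      have hj : j ∈ others a b := mem_others.2 ⟨by
        rintro rfl; obtain ⟨p, q, hz⟩ := hx.cell; omega, by rintro rfl; exact hx.ne_right rfl⟩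
      have t₁ := Finset.single_le_sum i₂ hi
      have t₂ := Finset.single_le_sum (f := fun j => if (cfg x w).Crossing (pt x a) (pt x b)
        (pt x i) (pt x j) then (1 : ℤ) else 0) (fun j _ => i₁ _) hj
      simp only [hx, if_true] at t₂
      omega
    · obtain ⟨i, rfl⟩ := hx.snd.right
      have hi : i ∈ others a b := mem_others.2 ⟨by
        rintro rfl; exact lt_asymm hx.fst.lt₁ hx.snd.lt₁, by rintro rfl; exact lt_irrefl _ hx.snd.lt₁⟩
      have t := Finset.single_le_sum (fun i _ => i₁ ((cfg x w).Chain (pt x a) (pt x b)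
        (pt x i) ∨ (cfg x w).Chain (pt x i) (pt x a) (pt x b))) hi
      simp only [hx, true_or, if_true] at t
      omega
    · obtain ⟨i, rfl⟩ := hx.fst.left
      have hi : i ∈ others a b := mem_others.2 ⟨by rintro rfl; exact lt_irrefl _ hx.fst.lt₁, by
        rintro rfl; exact lt_asymm hx.fst.lt₁ hx.snd.lt₁⟩
      have t := Finset.single_le_sum (fun i _ => i₁ ((cfg x w).Chain (pt x a) (pt x b)
        (pt x i) ∨ (cfg x w).Chain (pt x i) (pt x a) (pt x b))) hi
      simp only [hx, or_true, if_true] at t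
      omega

lemma invLen_eq_sum (x : Equiv.Perm (Fin n)) :
    (invLen x : ℤ) = ∑ i, ∑ j, if i < j ∧ x j < x i then 1 else 0 := by
  rw [invLen, Finset.natCast_card_filter, ← Finset.univ_product_univ, Finset.sum_product]

lemma invLen_lt_swap (h₁ : a < b) (h₂ : x a < x b) :
    invLen x < invLen (x * Equiv.swap a b) := by
  have hab : a ≠ b := h₁.ne
  have e : ∀ i ∈ others a b, (x * Equiv.swap a b) i = x i := fun i hi => by
    simp [Equiv.swap_apply_of_ne_of_ne (mem_others.1 hi).1 (mem_others.1 hi).2]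
  zify
  rw [invLen_eq_sum, invLen_eq_sum, sum_sum_split hab, sum_sum_split hab]
  have k : ∑ i ∈ others a b, ∑ j ∈ others a b, (if i < j ∧ (x * Equiv.swap a b) j <
      (x * Equiv.swap a b) i then (1 : ℤ) else 0) = _ :=
    Finset.sum_congr rfl fun i hi => Finset.sum_congr rfl fun j hj => by rw [e i hi, e j hj]
  rw [k]
  have ea : (x * Equiv.swap a b) a = x b := by simp
  have eb : (x * Equiv.swap a b) b = x a := by simp
  rw [ea, eb]
  simp only [lt_irrefl, false_and, if_false, h₁, h₂, lt_asymm h₁, lt_asymm h₂, and_self, if_true]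
  refine add_lt_add_of_lt_of_le (add_lt_add_of_lt_of_le (by norm_num)
    (Finset.sum_le_sum fun i hi => ?_)) le_rfl
  rw [e i hi]
  have := mem_others.1 hi
  have u := x.injective.ne this.1
  have v := x.injective.ne this.2
  grind

lemma lt_of_invLen_lt_swap (h₁ : a < b) (h : invLen x < invLen (x * Equiv.swap a b)) :
    x a < x b := by
  by_contra hn
  have h₂ : (x * Equiv.swap a b) a < (x * Equiv.swap a b) b := by
    simpa using lt_of_le_of_ne (not_lt.1 hn) (x.injective.ne h₁.ne')
  have := invLen_lt_swap h₁ h₂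
  rw [mul_assoc, Equiv.swap_mul_self, mul_one] at this
  exact lt_asymm h this

lemma bruhatLE_swap (h : bruhatLE x w) (hE : (cfg x w).Edge (pt x a) (pt x b)) :
    bruhatLE (x * Equiv.swap a b) w := by
  rw [bruhatLE_iff] at h ⊢
  rw [cfg_swap (pt_fst_lt.1 hE.lt₁) (pt_snd_lt.1 hE.lt₂)]
  intro p q
  have := hE.free p q
  have := h p q
  simp only [Config.swap]
  grind

lemma mem_R_of_edge (h : bruhatLE x w) (hE : (cfg x w).Edge (pt x a) (pt x b)) :
    Equiv.swap a b ∈ R x w := by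
  have h₁ := pt_fst_lt.1 hE.lt₁
  exact ⟨⟨a, b, h₁.ne, rfl⟩, invLen_lt_swap h₁ (pt_snd_lt.1 hE.lt₂), bruhatLE_swap h hE⟩

lemma edge_of_mem_R (h₁ : a < b) (h : Equiv.swap a b ∈ R x w) :
    (cfg x w).Edge (pt x a) (pt x b) := by
  have h₂ := lt_of_invLen_lt_swap h₁ h.2.1
  have h₃ := bruhatLE_iff.1 h.2.2
  rw [cfg_swap h₁ h₂] at h₃
  refine ⟨cfg_pt a, cfg_pt b, pt_fst_lt.2 h₁, pt_snd_lt.2 h₂, fun p q a b e f => ?_⟩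
  have := h₃ p q
  simp only [Config.swap] at this
  rw [if_pos ⟨a, b, e, f⟩] at this
  omega

lemma adj_of_mem_R (h : Equiv.swap a b ∈ R x w) : (cfg x w).Adj (pt x a) (pt x b) := by
  rcases lt_trichotomy a b with h₁ | rfl | h₁
  · exact Or.inl (edge_of_mem_R h₁ h)
  · have := h.2.1
    rw [Equiv.swap_self] at this
    exact absurd this (lt_irrefl _)
  · exact Or.inr (edge_of_mem_R h₁ (by rwa [Equiv.swap_comm]))

lemma swap_eq_swap {i j k l : Fin n} (h : i < j) (h' : k < l)
    (e : Equiv.swap i j = Equiv.swap k l) : i = k ∧ j = l := by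
  have e₁ := congrArg (· i) e
  have e₂ := congrArg (· j) e
  simp only [Equiv.swap_apply_left, Equiv.swap_apply_right, Equiv.swap_apply_def] at e₁ e₂
  grind

lemma ncard_R (h : bruhatLE x w) : (R x w).ncard =
    (Finset.univ.filter fun p : Fin n × Fin n => (cfg x w).Edge (pt x p.1) (pt x p.2)).card := by
  have e : R x w = (fun p : Fin n × Fin n => Equiv.swap p.1 p.2) '' ↑(Finset.univ.filter
      fun p : Fin n × Fin n => (cfg x w).Edge (pt x p.1) (pt x p.2)) := by
    ext t
    constructor
    · intro ht
      obtain ⟨a, b, hab, rfl⟩ := ht.1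
      rcases lt_or_gt_of_ne hab with h₁ | h₁
      · exact ⟨(a, b), by simpa using edge_of_mem_R h₁ ht, rfl⟩
      · exact ⟨(b, a), by simpa using edge_of_mem_R h₁ (by rwa [Equiv.swap_comm]),
          Equiv.swap_comm _ _⟩
    · rintro ⟨⟨a, b⟩, hE, rfl⟩
      exact mem_R_of_edge h (by simpa using hE)
  rw [e, Set.InjOn.ncard_image, Set.ncard_coe_finset]
  rintro ⟨i, j⟩ hi ⟨k, l⟩ hk hs
  simp only [Finset.coe_filter, Finset.mem_univ, true_and, Set.mem_ofPred_eq] at hi hk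
  obtain ⟨rfl, rfl⟩ := swap_eq_swap (pt_fst_lt.1 hi.lt₁) (pt_fst_lt.1 hk.lt₁) hs
  rfl

lemma total_eq_ncard (h : bruhatLE x w) : total x w = invLen x + ((R x w).ncard : ℤ) := by
  rw [total_eq, ncard_R h]

lemma exists_edge (h : bruhatLE x w) (hne : x ≠ w) :
    ∃ a b, (cfg x w).Edge (pt x a) (pt x b) := by
  have h' := bruhatLE_iff.1 h
  have hex : ∃ i, x i ≠ w i := by
    by_contra! hn
    exact hne (Equiv.ext hn)
  obtain ⟨i, hi, hmin⟩ := WellFounded.has_min (wellFounded_lt (α := Fin n)) {i | x i ≠ w i} hex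
  have hmin : ∀ k < i, x k = w k := fun k hk => by
    by_contra hn
    exact hmin k hn hk
  have hlt : x i < w i := by
    refine lt_of_le_of_ne (not_lt.1 fun hlt => ?_) hi
    have hd := h' (pt x i).1 (pt w i).2
    rw [cfg_d] at hd
    refine absurd hd (not_le.2 (Finset.sum_neg' (fun k _ => ?_) ⟨i, Finset.mem_univ _, ?_⟩))
    · have := hmin k
      rcases lt_trichotomy k i with hk | rfl | hk
      · simp [pt, hmin k hk]
      · simp only [pt]
        split_ifs <;> omega
      · simp [pt, not_le.2 hk]
    · simp [pt, hlt]
  have hne' : ({j | i < j ∧ x i < x j ∧ x j ≤ w i} : Set (Fin n)).Nonempty := by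
    refine ⟨x.symm (w i), ?_, by simpa, by simp⟩
    refine lt_of_le_of_ne (not_lt.1 fun hk => ?_) fun hk => ?_
    · have := hmin _ hk
      rw [Equiv.apply_symm_apply] at this
      exact absurd (w.injective this) hk.ne'
    · exact hi (by conv_lhs => rw [hk, Equiv.apply_symm_apply])
  obtain ⟨j, ⟨hij, hxj, hjw⟩, hmin'⟩ := WellFounded.has_min (wellFounded_lt (α := Fin n)) _ hne'
  refine ⟨i, j, cfg_pt i, cfg_pt j, pt_fst_lt.2 hij, pt_snd_lt.2 hxj, fun p q h₁ h₂ h₃ h₄ => ?_⟩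
  have hd := h' p (pt w i).2
  suffices hs : 1 ≤ (cfg x w).d p q - (cfg x w).d p (pt w i).2 by omega
  rw [cfg_d, cfg_d, ← Finset.sum_sub_distrib]
  have key : ∀ k : Fin n, (if k = i then (1 : ℤ) else 0) ≤
      ((if (pt w k).1 ≤ p ∧ q < (pt w k).2 then 1 else 0) -
        if (pt x k).1 ≤ p ∧ q < (pt x k).2 then 1 else 0) -
      ((if (pt w k).1 ≤ p ∧ (pt w i).2 < (pt w k).2 then 1 else 0) -
        if (pt x k).1 ≤ p ∧ (pt w i).2 < (pt x k).2 then 1 else 0) := by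
    intro k
    have m' : i < k → x i < x k → x k ≤ w i → j ≤ k := fun a b d => not_lt.1 (hmin' k ⟨a, b, d⟩)
    simp only [Fin.lt_def, Fin.le_def, pt] at *
    rcases lt_trichotomy (k : ℕ) i with hk | hk | hk
    · have : k ≠ i := fun e => absurd (congrArg Fin.val e) hk.ne
      rw [if_neg this]
      have := hmin k hk
      split_ifs <;> grind
    · obtain rfl := Fin.ext hk
      simp only [if_true]
      split_ifs <;> omega
    · specialize m' hk
      rw [if_neg (by grind)]
      split_ifs <;> omega
  calc (1 : ℤ) = ∑ k, if k = i then 1 else 0 := by simp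
    _ ≤ _ := Finset.sum_le_sum fun k _ => key k

lemma invLen_le (x : Equiv.Perm (Fin n)) : invLen x ≤ n * n := by
  refine (Finset.card_le_univ _).trans ?_
  simp

lemma invLen_le_total (h : bruhatLE x w) : (invLen w : ℤ) ≤ total x w := by
  induction hk : n * n - invLen x using Nat.strong_induction_on generalizing x with
  | _ k ih =>
    by_cases hxw : x = w
    · subst hxw
      rw [total_eq_ncard h]
      omega
    obtain ⟨a, b, hE⟩ := exists_edge h hxw
    have hlt := invLen_lt_swap (pt_fst_lt.1 hE.lt₁) (pt_snd_lt.1 hE.lt₂)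
    have hle := invLen_le (x * Equiv.swap a b)
    exact (ih _ (by omega) (bruhatLE_swap h hE) rfl).trans (total_swap_le hE)

lemma not_conflict (h : bruhatLE x w) (ht : total x w = invLen w)
    (hE : (cfg x w).Edge (pt x a) (pt x b)) : ¬ Conflict (cfg x w) (pt x a) (pt x b) := by
  rw [← total_swap_lt_iff hE, not_lt, ht]
  exact invLen_le_total (bruhatLE_swap h hE)

lemma good_cfg (h : MSP x w) : (cfg x w).Good := by
  obtain ⟨hle, hlt, hR⟩ := h
  have ht : ∀ a b, (cfg x w).Edge (pt x a) (pt x b) →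
      total (x * Equiv.swap a b) w = invLen w := by
    intro a b hE
    rw [total_eq_ncard (bruhatLE_swap hle hE)]
    have := hR _ (mem_R_of_edge hle hE)
    omega
  have hno : ∀ a b, (cfg x w).Edge (pt x a) (pt x b) → ∀ P Q,
      ((cfg x w).swap (pt x a) (pt x b)).Edge P Q →
      ¬ Conflict ((cfg x w).swap (pt x a) (pt x b)) P Q := by
    intro a b hE P Q hPQ
    rw [← cfg_swap (pt_fst_lt.1 hE.lt₁) (pt_snd_lt.1 hE.lt₂)] at hPQ ⊢
    obtain ⟨i, rfl⟩ := hPQ.left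
    obtain ⟨j, rfl⟩ := hPQ.right
    exact not_conflict (bruhatLE_swap hle hE) (ht a b hE) hPQ
  refine ⟨?_, ?_, ?_, ?_, ?_, ?_⟩
  · rintro _ _ ⟨i, rfl⟩ ⟨j, rfl⟩ e
    by_contra hn
    exact pt_fst_ne (fun h => hn (congrArg (pt x) h)) e
  · rintro _ _ ⟨i, rfl⟩ ⟨j, rfl⟩ e
    by_contra hn
    exact pt_snd_ne (fun h => hn (congrArg (pt x) h)) e
  · intro p q p' q' h₁ h₂ h₃
    by_contra! hn
    refine absurd h₃ (not_lt.2 ?_)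
    rw [cfg_d, cfg_d, cfg_d, cfg_d, ← Finset.sum_add_distrib, ← Finset.sum_add_distrib]
    refine Finset.sum_le_sum fun i _ => ?_
    have := hn (pt x i) (cfg_pt i)
    grind
  · rintro _ _ hE
    obtain ⟨i, rfl⟩ := hE.left
    obtain ⟨j, rfl⟩ := hE.right
    have : total (x * Equiv.swap i j) w < total x w := by
      rw [ht i j hE, total_eq_ncard hle]
      omega
    exact (total_swap_lt_iff hE).1 this
  · rintro _ _ hE P Q X Y hx
    obtain ⟨i, rfl⟩ := hE.left
    obtain ⟨j, rfl⟩ := hE.right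
    exact hno i j hE P Q hx.fst (Or.inl ⟨X, Y, hx⟩)
  · rintro _ _ hE X Y Z hx
    obtain ⟨i, rfl⟩ := hE.left
    obtain ⟨j, rfl⟩ := hE.right
    exact hno i j hE X Y hx.fst (Or.inr (Or.inl ⟨Z, hx⟩))

/-- Incomparability is transitive on the points indexed by `Δ(x,w)`. -/
lemma not_lt_of_mem_Delta (h : MSP x w) {i j k : Fin n} (hi : i ∈ Delta x w)
    (hj : j ∈ Delta x w) (hk : k ∈ Delta x w) (h₁ : ¬ (i < j ∧ x i < x j))
    (h₁' : ¬ (j < i ∧ x j < x i)) (h₂ : ¬ (j < k ∧ x j < x k)) (h₂' : ¬ (k < j ∧ x k < x j)) :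
    ¬ (i < k ∧ x i < x k) := by
  obtain ⟨a, ha⟩ := hi
  obtain ⟨b, hb⟩ := hj
  obtain ⟨d, hd⟩ := hk
  have := (good_cfg h).not_lt_trans (adj_of_mem_R ha) (adj_of_mem_R hb) (adj_of_mem_R hd)
  simp only [pt_fst_lt, pt_snd_lt] at this
  exact this h₁ h₁' h₂ h₂'

end Permutations

/-- If `x` is an MSP for `w`, then the flattening `x̃` of `x` along `Δ(x,w)` avoids
both the pattern `231` and the pattern `312`. -/
theorem msp_flattening_avoids_231_312 {n K : ℕ} (x w : Equiv.Perm (Fin n))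
    (hmsp : MSP x w) (hK : (DeltaFinset x w).card = K)
    (xt : Equiv.Perm (Fin K)) (hxt : IsFlatteningOn x (DeltaFinset x w) hK xt) :
    (¬ ∃ a b c : Fin K, a < b ∧ b < c ∧ xt c < xt a ∧ xt a < xt b) ∧
      (¬ ∃ a b c : Fin K, a < b ∧ b < c ∧ xt b < xt c ∧ xt c < xt a) := by
  have hm : ∀ a : Fin K, ((DeltaFinset x w).orderIsoOfFin hK a : Fin n) ∈ Delta x w := fun a => by
    have := ((DeltaFinset x w).orderIsoOfFin hK a).2
    simpa [DeltaFinset] using this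
  have hlt : ∀ a b : Fin K, a < b ↔ ((DeltaFinset x w).orderIsoOfFin hK a : Fin n) <
      (DeltaFinset x w).orderIsoOfFin hK b := fun a b => by
    rw [Subtype.coe_lt_coe, OrderIso.lt_iff_lt]
  have key : ∀ a b c : Fin K, ¬ (a < b ∧ xt a < xt b) → ¬ (b < a ∧ xt b < xt a) →
      ¬ (b < c ∧ xt b < xt c) → ¬ (c < b ∧ xt c < xt b) → ¬ (a < c ∧ xt a < xt c) := by
    intro a b c
    rw [hxt, hxt, hxt, hxt, hxt, hlt, hlt, hlt, hlt, hlt]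
    exact not_lt_of_mem_Delta hmsp (hm a) (hm b) (hm c)
  constructor
  · rintro ⟨a, b, c, h₁, h₂, h₃, h₄⟩
    exact key a c b (by omega) (by omega) (by omega) (by omega) ⟨h₁, h₄⟩
  · rintro ⟨a, b, c, h₁, h₂, h₃, h₄⟩
    exact key b a c (by omega) (by omega) (by omega) (by omega) ⟨h₂, h₃⟩

end BSW
end
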